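/- arXiv:2110.15540 — 3 statements merged into one kernel-verified Lean document; each statement's English description precedes it below -/
import Mathlib

section
/- Let d ≥ 2, β > 0, Λ ⋐ Z^d, and ω ∈ Ω_Λ^+. Then exp(-H_{Φ^β,Λ}(ω)) = e^{β|𝓔_Λ|} · Π_{γ∈Γ(ω)} e^{-2β|γ|}, where 𝓔_Λ = {{x,y} ⊆ Z^d : ‖x-y‖_1 = 1, {x,y} ∩ Λ ≠ ∅}. -/
open scoped BigOperators
open Real MeasureTheory Filter Topology

namespace Ising

/-- The lattice `ℤ^d`. -/
abbrev V (d : ℕ) := Fin d → ℤ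
/-- Spin configurations on `ℤ^d`; `true` encodes spin `+1`, `false` encodes spin `-1`. -/
abbrev Config (d : ℕ) := V d → Bool
/-- The ambient euclidean space `ℝ^d`. -/
abbrev Point (d : ℕ) := Fin d → ℝ

variable {d : ℕ}

noncomputable section

/-- The spin value (`±1`) of a boolean. -/
def spin (b : Bool) : ℝ := if b then 1 else -1

/-- An interaction assigns to each finite `Λ ⊆ ℤ^d` a function of configurations
(only the restriction to `Λ` is relevant; see `IsLocal`). -/
abbrev Interaction (d : ℕ) := Finset (V d) → Config d → ℝ

/-- `Φ_Λ` depends only on the restriction of the configuration to `Λ`. -/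
def IsLocal (Φ : Interaction d) : Prop :=
  ∀ (Λ : Finset (V d)) (ω ω' : Config d), (∀ x ∈ Λ, ω x = ω' x) → Φ Λ ω = Φ Λ ω'

/-- Translation of a configuration: `(τ^a ω)(x) = ω(x+a)`. -/
def translate (a : V d) (ω : Config d) : Config d := fun x => ω (x + a)

/-- Translation invariance of an interaction: `Φ_Λ(ω) = Φ_{Λ-a}(τ^a ω)`. -/
def TransInv (Φ : Interaction d) : Prop :=
  ∀ (a : V d) (Λ : Finset (V d)) (ω : Config d),
    Φ (Λ.image (fun x => x - a)) (translate a ω) = Φ Λ ω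

/-- Spin-flip symmetry: `Ψ_Λ(ω) = Ψ_Λ(-ω)`. -/
def SpinFlipSymm (Ψ : Interaction d) : Prop :=
  ∀ (Λ : Finset (V d)) (ω : Config d), Ψ Λ (fun x => !(ω x)) = Ψ Λ ω

/-- `sup_{ω ∈ Ω_Λ} |Φ_Λ(ω)|`. -/
def supNorm (Φ : Interaction d) (Λ : Finset (V d)) : ℝ := ⨆ ω : Config d, |Φ Λ ω|

/-- The summand of the norm `‖Φ‖`. -/
def normTerm (Φ : Interaction d) (Λ : Finset (V d)) : ℝ :=
  if (0 : V d) ∈ Λ then supNorm Φ Λ else 0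

/-- `‖Φ‖ = Σ_{0 ∈ Λ ⋐ ℤ^d} sup_{ω} |Φ_Λ(ω)|`. -/
def anorm (Φ : Interaction d) : ℝ := ∑' Λ : Finset (V d), normTerm Φ Λ

/-- Absolute summability of an interaction. -/
def AbsSummable (Φ : Interaction d) : Prop := Summable (normTerm Φ)

/-- `‖x-y‖_∞`. -/
def distInf (x y : V d) : ℕ := Finset.univ.sup fun i => (x i - y i).natAbs

/-- `‖x-y‖_1`. -/
def dist1 (x y : V d) : ℕ := ∑ i, (x i - y i).natAbs

/-- `diam(Λ) = sup {‖x-y‖_∞ : x, y ∈ Λ}`. -/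
def diam (Λ : Finset (V d)) : ℕ := Λ.sup fun x => Λ.sup fun y => distInf x y

/-- The summand of the `d`-th order decaying norm `|||Ψ|||`. -/
def dTerm (Ψ : Interaction d) (Λ : Finset (V d)) : ℝ :=
  if (0 : V d) ∈ Λ then ((diam Λ + 1 : ℕ) : ℝ) ^ d * supNorm Ψ Λ else 0

/-- `|||Ψ||| = Σ_{0 ∈ Λ ⋐ ℤ^d} (diam(Λ)+1)^d sup_{ω} |Ψ_Λ(ω)|`. -/
def dnorm (Ψ : Interaction d) : ℝ := ∑' Λ : Finset (V d), dTerm Ψ Λ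

/-- Summability of the `d`-th order decaying norm. -/
def DSummable (Ψ : Interaction d) : Prop := Summable (dTerm Ψ)

/-- The summand of the norm `|||Ψ|||'`. -/
def dTerm' (Ψ : Interaction d) (Λ : Finset (V d)) : ℝ :=
  if (0 : V d) ∈ Λ then (Λ.card : ℝ)⁻¹ * ((diam Λ + 1 : ℕ) : ℝ) ^ d * supNorm Ψ Λ else 0

/-- `|||Ψ|||' = Σ_{0 ∈ Λ ⋐ ℤ^d} |Λ|⁻¹ (diam(Λ)+1)^d sup_{ω} |Ψ_Λ(ω)|`. -/
def dnorm' (Ψ : Interaction d) : ℝ := ∑' Λ : Finset (V d), dTerm' Ψ Λ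

/-- Summability of the norm `|||·|||'`. -/
def DSummable' (Ψ : Interaction d) : Prop := Summable (dTerm' Ψ)

/-- The Hamiltonian `H_{Φ,Λ}(ω) = Σ_{Δ ⋐ ℤ^d, Δ ∩ Λ ≠ ∅} Φ_Δ(ω|_Δ)`. -/
def ham (Φ : Interaction d) (Λ : Finset (V d)) (ω : Config d) : ℝ :=
  ∑' Δ : Finset (V d), if (Δ ∩ Λ).Nonempty then Φ Δ ω else 0

/-- The configuration `ω_Λ ∨ η` agreeing with `f` on `Λ` and with `η` off `Λ`. -/
def fill (Λ : Finset (V d)) (f : ↥Λ → Bool) (η : Config d) : Config d :=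
  fun x => if h : x ∈ Λ then f ⟨x, h⟩ else η x

/-- The partition function `Z^η_{Φ,Λ}`. -/
def gibbsZ (Φ : Interaction d) (Λ : Finset (V d)) (η : Config d) : ℝ :=
  ∑ f : ↥Λ → Bool, Real.exp (-(ham Φ Λ (fill Λ f η)))

/-- The finite Gibbs state `μ^η_{Φ,Λ}({ω_Λ})`. -/
def finGibbs (Φ : Interaction d) (Λ : Finset (V d)) (η : Config d) (f : ↥Λ → Bool) : ℝ :=
  Real.exp (-(ham Φ Λ (fill Λ f η))) / gibbsZ Φ Λ η

/-- The cylinder set `{ξ : ξ|_Λ = f}`. -/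
def cyl (Λ : Finset (V d)) (f : ↥Λ → Bool) : Set (Config d) :=
  {ξ | ∀ (x : V d) (h : x ∈ Λ), ξ x = f ⟨x, h⟩}

/-- `σ` is a Gibbs state for `Φ` (DLR condition): for each finite `Λ` there is a Borel
probability measure on boundary conditions with respect to which `σ` of each cylinder
is the average of the finite Gibbs states. -/
def IsGibbs (Φ : Interaction d) (σ : Measure (Config d)) : Prop :=
  IsProbabilityMeasure σ ∧
  ∀ Λ : Finset (V d), ∃ ν : Measure (Config d), IsProbabilityMeasure ν ∧
    ∀ f : ↥Λ → Bool, (σ (cyl Λ f)).toReal = ∫ η, finGibbs Φ Λ η f ∂ν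

/-- Translation invariance of a measure: `τ^a_* σ = σ`. -/
def MeasTransInv (σ : Measure (Config d)) : Prop :=
  ∀ a : V d, σ.map (translate a) = σ

/-- The Ising interaction at inverse temperature `β`:
`Φ^β_Λ(ω) = -β ω(x) ω(y)` if `Λ = {x,y}` with `‖x-y‖₁ = 1`, and `0` otherwise. -/
def ising (β : ℝ) : Interaction d := fun Λ ω =>
  if Λ.card = 2 ∧ ∀ x ∈ Λ, ∀ y ∈ Λ, x ≠ y → dist1 x y = 1
  then -β * ∏ x ∈ Λ, spin (ω x) else 0

/-- The sum of two interactions. -/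
def Iadd (Φ Ψ : Interaction d) : Interaction d := fun Λ ω => Φ Λ ω + Ψ Λ ω

/-- `S` is connected for the adjacency given by `ρ`-distance `1`. -/
def ConnectedBy (ρ : V d → V d → ℕ) (S : Set (V d)) : Prop :=
  ∀ x ∈ S, ∀ y ∈ S, ∃ (n : ℕ) (p : ℕ → V d), p 0 = x ∧ p n = y ∧
    (∀ i ≤ n, p i ∈ S) ∧ ∀ i < n, ρ (p i) (p (i+1)) = 1

/-- `‖·‖₁`-connectedness. -/
def Conn1 (S : Set (V d)) : Prop := ConnectedBy dist1 S

/-- `‖·‖_∞`-connectedness. -/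
def ConnInf (S : Set (V d)) : Prop := ConnectedBy distInf S

/-- A finite set `Λ` is c-connected if both `Λ` and its complement are `‖·‖_∞`-connected. -/
def CConn (Λ : Finset (V d)) : Prop :=
  ConnInf (↑Λ : Set (V d)) ∧ ConnInf ((↑Λ : Set (V d))ᶜ)

/-- `Ψ` vanishes on sets that are not `‖·‖₁`-connected. -/
def ZeroOnNonConn (Ψ : Interaction d) : Prop :=
  ∀ Λ : Finset (V d), ¬ Conn1 (↑Λ : Set (V d)) → ∀ ω, Ψ Λ ω = 0

/-- The closed unit cube `I_x` centered at `x ∈ ℤ^d`. -/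
def cube (x : V d) : Set (Point d) := {y | ∀ i, |y i - (x i : ℝ)| ≤ 1/2}

/-- `M(S) = ⋃_{x ∈ S} I_x`. -/
def cubes (S : Set (V d)) : Set (Point d) := ⋃ x ∈ S, cube x

/-- A contour is the boundary `∂M(S)` of `M(S)` for a finite c-connected `S`. -/
def IsContour (γ : Set (Point d)) : Prop :=
  ∃ S : Finset (V d), CConn S ∧ γ = frontier (cubes ↑S)

/-- The set of sites with spin `-1`. -/
def minusSet (ω : Config d) : Set (V d) := {x | ω x = false}

/-- `Γ(ω)`: the connected components of `∂M({x : ω(x) = -1})`. -/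
def Gamma (ω : Config d) : Set (Set (Point d)) :=
  {γ | ∃ y ∈ frontier (cubes (minusSet ω)),
    γ = connectedComponentIn (frontier (cubes (minusSet ω))) y}

/-- The `(d-1)`-dimensional face of the unit cubes lying between `x` and `x + e_i`. -/
def face (x : V d) (i : Fin d) : Set (Point d) :=
  {y | y i = (x i : ℝ) + 1/2 ∧ ∀ j, j ≠ i → |y j - (x j : ℝ)| ≤ 1/2}

/-- A plaquette is a `(d-1)`-dimensional face of one of the cubes `I_x`. -/
def IsPlaquette (P : Set (Point d)) : Prop := ∃ x i, P = face x i

/-- `|γ|`: the number of plaquettes contained in `γ`. -/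
def csize (γ : Set (Point d)) : ℕ :=
  Nat.card {P : Set (Point d) // IsPlaquette P ∧ P ⊆ γ}

/-- The constant `+1` configuration. -/
def plusC : Config d := fun _ => true

/-- The constant `-1` configuration. -/
def minusC : Config d := fun _ => false

open scoped Classical in
/-- The finite-volume Gibbs probability (with boundary condition `η`) of an event
`A`: `μ^η_{Φ,Λ}({ω : ω ∨ η ∈ A})`. -/
def bcProb (Φ : Interaction d) (Λ : Finset (V d)) (η : Config d) (A : Set (Config d)) : ℝ :=
  (∑ f : ↥Λ → Bool, if fill Λ f η ∈ A then Real.exp (-(ham Φ Λ (fill Λ f η))) else 0) /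
    gibbsZ Φ Λ η

/-- `ω ∈ Ω_Λ^+`, i.e. `ω` is `+1` off `Λ`. -/
def plusOutside (Λ : Finset (V d)) (ω : Config d) : Prop := ∀ x, x ∉ Λ → ω x = true

/-- The configuration obtained by flipping all spins in `S`. -/
def flipOn (S : Finset (V d)) (ω : Config d) : Config d :=
  fun x => if x ∈ S then !(ω x) else ω x

/-- `|𝓔_Λ|`: the number of nearest-neighbour edges meeting `Λ`. -/
def edgeCount (Λ : Finset (V d)) : ℕ :=
  Nat.card {e : Finset (V d) // (∃ x y, e = {x, y} ∧ dist1 x y = 1) ∧ (e ∩ Λ).Nonempty}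

/-- `R` is a (nonempty) rectangle in `ℤ^d`. -/
def IsRect (R : Finset (V d)) : Prop := ∃ a b : V d, a ≤ b ∧ R = Finset.Icc a b

/-- `R(Λ)`: the minimal rectangle containing `Λ`. -/
def minRect (Λ : Finset (V d)) : Finset (V d) :=
  if h : Λ.Nonempty then
    Finset.Icc (fun i => Λ.inf' h fun x => x i) (fun i => Λ.sup' h fun x => x i)
  else ∅

open scoped Classical in
/-- The rectangle regrouping `Ψ̃` of `Ψ`: `Ψ̃_R(ω) = Σ_{Λ : R(Λ) = R} Ψ_Λ(ω|_Λ)` for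
rectangles `R`, and `Ψ̃_Λ = 0` for non-rectangles. -/
def regroup (Ψ : Interaction d) : Interaction d := fun R ω =>
  if IsRect R then ∑ Λ ∈ R.powerset, (if minRect Λ = R then Ψ Λ ω else 0) else 0


/-- The edge `{x, x + e_i}`. -/
def edgeOf (t : V d × Fin d) : Finset (V d) := {t.1, t.1 + Pi.single t.2 1}

/-- The center of the face `face x i`. -/
def ctr (t : V d × Fin d) : Point d := fun j => (t.1 j : ℝ) + if j = t.2 then 1/2 else 0

lemma ctr_mem (x : V d) (i : Fin d) : ctr (x, i) ∈ face x i := by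
  refine ⟨by simp [ctr], fun j hj => by simp [ctr, hj]⟩

lemma int_eq_of_abs_lt {a b : ℤ} (h : |(a : ℝ) - b| < 1) : a = b := by
  have h2 : |a - b| < 1 := by exact_mod_cast h
  have := Int.abs_lt_one_iff.1 h2
  omega

lemma face_inj {x y : V d} {i j : Fin d} (h : ctr (x, i) ∈ face y j) : (x, i) = (y, j) := by
  obtain ⟨h1, h2⟩ := h
  have hij : j = i := by
    by_contra hne
    simp only [ctr, hne, if_false, add_zero] at h1
    have h3 : (2 * x j : ℝ) = 2 * y j + 1 := by linarith
    have h4 : 2 * x j = 2 * y j + 1 := by exact_mod_cast h3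
    omega
  subst hij
  have : x = y := by
    funext k
    by_cases hk : k = j
    · subst hk
      simp only [ctr, if_true] at h1
      have h3 : (x k : ℝ) = y k := by linarith
      exact_mod_cast h3
    · have h3 := h2 k hk
      simp only [ctr, hk, if_false, add_zero] at h3
      exact int_eq_of_abs_lt (by linarith)
  rw [this]

lemma cube_eq (x : V d) : cube x = Metric.closedBall (fun i => (x i : ℝ)) (1/2) := by
  ext p
  rw [Metric.mem_closedBall, dist_pi_le_iff (by norm_num)]
  simp [cube, Real.dist_eq]

lemma mem_ball_iff (c p : Point d) (r : ℝ) (hr : 0 < r) :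
    p ∈ Metric.ball c r ↔ ∀ i, |p i - c i| < r := by
  rw [Metric.mem_ball, dist_pi_lt_iff hr]
  simp [Real.dist_eq]

lemma cube_subset_closure_compl (S : Set (V d)) {z : V d} (hz : z ∉ S) :
    cube z ⊆ closure (cubes S)ᶜ := by
  rw [cube_eq, ← closure_ball _ (by norm_num)]
  apply closure_mono
  intro p hp hpS
  rw [mem_ball_iff _ _ _ (by norm_num)] at hp
  simp only [cubes, Set.mem_iUnion] at hpS
  obtain ⟨w, hw, hpw⟩ := hpS
  apply hz
  have : z = w := by
    funext j
    apply int_eq_of_abs_lt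
    have h1 := abs_lt.1 (hp j)
    have h2 := abs_le.1 (hpw j)
    rw [abs_lt]
    constructor <;> linarith [h1.1, h1.2, h2.1, h2.2]
  rwa [this]

lemma cube_subset_cubes (S : Set (V d)) {z : V d} (hz : z ∈ S) : cube z ⊆ cubes S := by
  intro p hp
  simp only [cubes, Set.mem_iUnion]
  exact ⟨z, hz, hp⟩

lemma face_subset_cube (x : V d) (i : Fin d) : face x i ⊆ cube x := by
  rintro p ⟨h1, h2⟩ j
  by_cases hj : j = i
  · subst hj
    rw [h1, abs_le]; constructor <;> linarith
  · exact h2 j hj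

lemma face_subset_cube' (x : V d) (i : Fin d) : face x i ⊆ cube (x + Pi.single i 1) := by
  rintro p ⟨h1, h2⟩ j
  by_cases hj : j = i
  · subst hj
    simp only [Pi.add_apply, Pi.single_eq_same]
    push_cast
    rw [h1, abs_le]; constructor <;> linarith
  · simpa [hj] using h2 j hj

lemma ball_subset (x : V d) (i : Fin d) {p : Point d} (hp : p ∈ Metric.ball (ctr (x, i)) (1/2)) :
    p ∈ cube x ∨ p ∈ cube (x + Pi.single i 1) := by
  rw [mem_ball_iff _ _ _ (by norm_num)] at hp
  rcases le_total (p i) (x i + 1/2) with h | h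
  · left
    intro j
    have h1 := abs_lt.1 (hp j)
    by_cases hj : j = i
    · subst hj
      simp only [ctr, if_true] at h1
      rw [abs_le]; constructor <;> linarith [h1.1, h1.2]
    · simp only [ctr, hj, if_false] at h1
      rw [abs_le]; constructor <;> linarith [h1.1, h1.2]
  · right
    intro j
    have h1 := abs_lt.1 (hp j)
    by_cases hj : j = i
    · subst hj
      simp only [ctr, if_true] at h1
      simp only [Pi.add_apply, Pi.single_eq_same]
      push_cast
      rw [abs_le]; constructor <;> linarith [h1.1, h1.2]
    · simp only [ctr, hj, if_false] at h1
      simp only [Pi.add_apply, Pi.single_eq_of_ne hj]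
      push_cast
      rw [abs_le]; constructor <;> linarith [h1.1, h1.2]

lemma ball_cube (x w : V d) (i : Fin d) {p : Point d} (hp : p ∈ Metric.ball (ctr (x, i)) (1/2))
    (hw : p ∈ cube w) : w = x ∨ w = x + Pi.single i 1 := by
  rw [mem_ball_iff _ _ _ (by norm_num)] at hp
  have hne : ∀ j, j ≠ i → w j = x j := by
    intro j hj
    have h1 := abs_lt.1 (hp j)
    have h2 := abs_le.1 (hw j)
    simp only [ctr, hj, if_false] at h1
    apply int_eq_of_abs_lt
    rw [abs_lt]; constructor <;> linarith [h1.1, h1.2, h2.1, h2.2]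
  have h1 := abs_lt.1 (hp i)
  have h2 := abs_le.1 (hw i)
  simp only [ctr, if_true] at h1
  have h3 : (-1 : ℝ) < w i - x i := by linarith [h1.1, h1.2, h2.1, h2.2]
  have h4 : (w i - x i : ℝ) < 2 := by linarith [h1.1, h1.2, h2.1, h2.2]
  have h5 : -1 < w i - x i := by exact_mod_cast h3
  have h6 : w i - x i < 2 := by exact_mod_cast h4
  have h7 : w i = x i ∨ w i = x i + 1 := by omega
  rcases h7 with h7 | h7
  · left
    funext j
    by_cases hj : j = i
    · rw [hj, h7]
    · exact hne j hj
  · right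
    funext j
    by_cases hj : j = i
    · subst hj; simp [h7]
    · simp [hj, hne j hj]

lemma face_subset_frontier_iff (S : Set (V d)) (x : V d) (i : Fin d) :
    face x i ⊆ frontier (cubes S) ↔ ¬ (x ∈ S ↔ x + Pi.single i 1 ∈ S) := by
  constructor
  · intro h hiff
    have hc := h (ctr_mem x i)
    have hb : Metric.ball (ctr (x, i)) (1/2) ∈ 𝓝 (ctr (x, i)) :=
      Metric.ball_mem_nhds _ (by norm_num)
    by_cases hx : x ∈ S
    · apply hc.2
      rw [mem_interior_iff_mem_nhds]
      refine Filter.mem_of_superset hb fun p hp => ?_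
      rcases ball_subset x i hp with h1 | h1
      · exact cube_subset_cubes S hx h1
      · exact cube_subset_cubes S (hiff.1 hx) h1
    · obtain ⟨p, hp, hpS⟩ := mem_closure_iff_nhds.1 hc.1 _ hb
      simp only [cubes, Set.mem_iUnion] at hpS
      obtain ⟨w, hw, hpw⟩ := hpS
      rcases ball_cube x w i hp hpw with h1 | h1
      · exact hx (h1 ▸ hw)
      · exact hx (hiff.2 (h1 ▸ hw))
  · intro h p hp
    rw [frontier_eq_closure_inter_closure]
    have h1 := face_subset_cube x i hp
    have h2 := face_subset_cube' x i hp
    by_cases hx : x ∈ S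
    · have hy : x + Pi.single i 1 ∉ S := fun hy => h ⟨fun _ => hy, fun _ => hx⟩
      exact ⟨subset_closure (cube_subset_cubes S hx h1), cube_subset_closure_compl S hy h2⟩
    · have hy : x + Pi.single i 1 ∈ S := by
        by_contra hy
        exact h ⟨fun h => absurd h hx, fun h => absurd h hy⟩
      exact ⟨subset_closure (cube_subset_cubes S hy h2), cube_subset_closure_compl S hx h1⟩

lemma face_preconnected (x : V d) (i : Fin d) : IsPreconnected (face x i) := by
  apply Convex.isPreconnected
  have : face x i = Set.pi Set.univ (fun j => if j = i then {(x i : ℝ) + 1/2}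
      else Metric.closedBall (x j : ℝ) (1/2)) := by
    ext p
    simp only [face, Set.mem_ofPred_eq, Set.mem_pi, Set.mem_univ, true_imp_iff]
    constructor
    · rintro ⟨h1, h2⟩ j
      by_cases hj : j = i
      · subst hj; simpa using h1
      · simpa [hj, Real.dist_eq] using h2 j hj
    · intro h
      refine ⟨by simpa using h i, fun j hj => ?_⟩
      simpa [hj, Real.dist_eq] using h j
  rw [this]
  apply convex_pi
  intro j _
  by_cases hj : j = i
  · simp [hj]
  · simp only [hj, if_false]; exact convex_closedBall _ _

lemma edgeOf_inj : Function.Injective (edgeOf (d := d)) := by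
  rintro ⟨x, i⟩ ⟨y, j⟩ h
  have hx : x ∈ edgeOf (y, j) := by rw [← h]; simp [edgeOf]
  have hx' : x + Pi.single i 1 ∈ edgeOf (y, j) := by rw [← h]; simp [edgeOf]
  simp only [edgeOf, Finset.mem_insert, Finset.mem_singleton] at hx hx'
  rcases hx with rfl | rfl
  · rcases hx' with h1 | h1
    · have := congrFun h1 i
      simp at this
    · have h2 := add_left_cancel h1
      have h3 := congrFun h2 i
      have : i = j := by
        by_contra hne
        simp [hne] at h3
      rw [this]
  · rcases hx' with h1 | h1
    · have h2 := congrFun h1 i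
      by_cases hij : i = j
      · subst hij; simp at h2; omega
      · simp [hij] at h2
    · have h2 := congrFun h1 i
      simp at h2

lemma dist1_edge (x : V d) (i : Fin d) : dist1 x (x + Pi.single i 1) = 1 := by
  unfold dist1
  rw [Finset.sum_eq_single i]
  · simp
  · intro j _ hj; simp [hj]
  · simp

lemma dist1_edge' (x : V d) (i : Fin d) : dist1 (x + Pi.single i 1) x = 1 := by
  unfold dist1
  rw [Finset.sum_eq_single i]
  · simp
  · intro j _ hj; simp [hj]
  · simp

lemma edge_of_dist1 {x y : V d} (h : dist1 x y = 1) : ∃ t, ({x, y} : Finset (V d)) = edgeOf t := by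
  unfold dist1 at h
  obtain ⟨i, hi0⟩ : ∃ i, (x i - y i).natAbs ≠ 0 := by
    by_contra hall
    push Not at hall
    simp [hall] at h
  rw [← Finset.add_sum_erase _ _ (Finset.mem_univ i)] at h
  have hi : (x i - y i).natAbs = 1 := by omega
  have hz : ∑ j ∈ Finset.univ.erase i, (x j - y j).natAbs = 0 := by omega
  have hu : ∀ j ∈ Finset.univ, j ≠ i → (x j - y j).natAbs = 0 := fun j hj hji =>
    (Finset.sum_eq_zero_iff.1 hz) j (Finset.mem_erase.2 ⟨hji, hj⟩)
  have hne : ∀ j, j ≠ i → x j = y j := by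
    intro j hj
    have := hu j (Finset.mem_univ j) hj
    omega
  have h7 : y i = x i + 1 ∨ x i = y i + 1 := by omega
  rcases h7 with h7 | h7
  · refine ⟨(x, i), ?_⟩
    have : y = x + Pi.single i 1 := by
      funext j
      by_cases hj : j = i
      · subst hj; simp [h7]
      · simp [hj, hne j hj]
    rw [this]; rfl
  · refine ⟨(y, i), ?_⟩
    have : x = y + Pi.single i 1 := by
      funext j
      by_cases hj : j = i
      · subst hj; simp [h7]
      · simp [hj, hne j hj]
    rw [this, Finset.pair_comm]; rfl

lemma ne_add_single (x : V d) (i : Fin d) : x ≠ x + Pi.single i 1 := by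
  intro h
  have := congrFun h i
  simp at this

lemma ising_edge (β : ℝ) (ω : Config d) (x : V d) (i : Fin d) :
    ising β (edgeOf (x, i)) ω = -β * (spin (ω x) * spin (ω (x + Pi.single i 1))) := by
  unfold ising
  have hne := ne_add_single x i
  rw [if_pos]
  · simp only [edgeOf]
    rw [Finset.prod_pair hne]
  · refine ⟨Finset.card_pair hne, ?_⟩
    intro a ha b hb hab
    simp only [edgeOf, Finset.mem_insert, Finset.mem_singleton] at ha hb
    rcases ha with rfl | rfl <;> rcases hb with rfl | rfl
    · exact absurd rfl hab
    · exact dist1_edge _ _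
    · exact dist1_edge' _ _
    · exact absurd rfl hab

lemma ising_ne_zero {β : ℝ} {ω : Config d} {Δ : Finset (V d)} (h : ising β Δ ω ≠ 0) :
    ∃ t, Δ = edgeOf t := by
  unfold ising at h
  have h1 := (ite_ne_right_iff.1 h).1
  obtain ⟨x, y, hxy, rfl⟩ := Finset.card_eq_two.1 h1.1
  exact edge_of_dist1 (h1.2 x (by simp) y (by simp) hxy)

/-- The edges meeting `Λ`. -/
def edgesOf (Λ : Finset (V d)) : Finset (V d × Fin d) :=
  (Λ ×ˢ Finset.univ) ∪
    (Λ ×ˢ Finset.univ).image (fun t => (t.1 - Pi.single t.2 1, t.2))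

lemma mem_edgesOf (Λ : Finset (V d)) (t : V d × Fin d) :
    t ∈ edgesOf Λ ↔ (edgeOf t ∩ Λ).Nonempty := by
  obtain ⟨x, i⟩ := t
  have : (edgeOf (x, i) ∩ Λ).Nonempty ↔ x ∈ Λ ∨ x + Pi.single i 1 ∈ Λ := by
    simp [Finset.Nonempty, edgeOf, or_and_right, exists_or]
  rw [this]
  simp only [edgesOf, Finset.mem_union, Finset.mem_product, Finset.mem_univ, and_true,
    Finset.mem_image, Prod.mk.injEq, Prod.exists]
  apply or_congr Iff.rfl
  constructor
  · rintro ⟨a, b, ha, hab, rfl⟩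
    rw [← hab]; simpa using ha
  · intro h
    exact ⟨_, i, h, by simp, rfl⟩

lemma edgeCount_eq (Λ : Finset (V d)) : edgeCount Λ = (edgesOf Λ).card := by
  unfold edgeCount
  rw [← Finset.card_image_of_injective _ edgeOf_inj]
  apply Nat.subtype_card
  intro e
  rw [Finset.mem_image]
  constructor
  · rintro ⟨t, ht, rfl⟩
    exact ⟨⟨_, _, rfl, dist1_edge _ _⟩, (mem_edgesOf Λ t).1 ht⟩
  · rintro ⟨⟨x, y, rfl, h⟩, hn⟩
    obtain ⟨t, ht⟩ := edge_of_dist1 h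
    rw [ht] at hn ⊢
    exact ⟨t, (mem_edgesOf Λ t).2 hn, rfl⟩

/-- The disagreement edges. -/
def disag (Λ : Finset (V d)) (ω : Config d) : Finset (V d × Fin d) :=
  (edgesOf Λ).filter (fun t => ω t.1 ≠ ω (t.1 + Pi.single t.2 1))

lemma ham_eq (β : ℝ) (Λ : Finset (V d)) (ω : Config d) :
    ham (ising β) Λ ω = -β * ((edgesOf Λ).card - 2 * (disag Λ ω).card) := by
  unfold ham
  rw [tsum_eq_sum (s := (edgesOf Λ).image edgeOf), Finset.sum_image edgeOf_inj.injOn]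
  · have : ∀ t ∈ edgesOf Λ,
        (if (edgeOf t ∩ Λ).Nonempty then ising β (edgeOf t) ω else 0) =
        -β * (1 - 2 * if ω t.1 ≠ ω (t.1 + Pi.single t.2 1) then 1 else 0) := by
      rintro ⟨x, i⟩ ht
      rw [if_pos ((mem_edgesOf Λ _).1 ht), ising_edge]
      congr 1
      dsimp only
      cases ω x <;> cases ω (x + Pi.single i 1) <;> norm_num [spin]
    rw [Finset.sum_congr rfl this, ← Finset.mul_sum, Finset.sum_sub_distrib, ← Finset.mul_sum,
      Finset.sum_boole]
    simp [disag]
  · intro Δ hΔ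
    by_contra hne
    rw [ite_eq_right_iff] at hne
    push Not at hne
    obtain ⟨h1, h2⟩ := hne
    obtain ⟨t, rfl⟩ := ising_ne_zero h2
    exact hΔ (Finset.mem_image_of_mem _ ((mem_edgesOf Λ t).2 h1))

lemma face_subset_iff_disag {Λ : Finset (V d)} {ω : Config d} (hω : plusOutside Λ ω)
    (t : V d × Fin d) :
    face t.1 t.2 ⊆ frontier (cubes (minusSet ω)) ↔ t ∈ disag Λ ω := by
  obtain ⟨x, i⟩ := t
  rw [face_subset_frontier_iff]
  simp only [disag, Finset.mem_filter, mem_edgesOf, minusSet, Set.mem_ofPred_eq]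
  have hor : ω x ≠ ω (x + Pi.single i 1) → (edgeOf (x, i) ∩ Λ).Nonempty := by
    intro h
    by_cases hx : x ∈ Λ
    · exact ⟨x, by simp [edgeOf, hx]⟩
    · by_cases hy : x + Pi.single i 1 ∈ Λ
      · exact ⟨x + Pi.single i 1, by simp [edgeOf, hy]⟩
      · exact absurd ((hω _ hx).trans (hω _ hy).symm) h
  have h2 : ¬(ω x = false ↔ ω (x + Pi.single i 1) = false) ↔ ω x ≠ ω (x + Pi.single i 1) := by
    cases ω x <;> cases ω (x + Pi.single i 1) <;> simp
  rw [h2]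
  exact ⟨fun h => ⟨hor h, h⟩, fun h => h.2⟩

/-- The component of the contour set containing the center of a face. -/
def compOf (ω : Config d) (t : V d × Fin d) : Set (Point d) :=
  connectedComponentIn (frontier (cubes (minusSet ω))) (ctr t)

open scoped Classical in
lemma csize_eq {Λ : Finset (V d)} {ω : Config d} (hω : plusOutside Λ ω)
    {γ : Set (Point d)} (hγ : γ ∈ Gamma ω) :
    csize γ = ((disag Λ ω).filter (fun t => compOf ω t = γ)).card := by
  unfold csize
  have hinj : Function.Injective (fun t : V d × Fin d => face t.1 t.2) := by
    rintro ⟨x, i⟩ ⟨y, j⟩ h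
    apply face_inj
    dsimp only at h
    rw [← h]
    exact ctr_mem x i
  rw [← Finset.card_image_of_injective _ hinj]
  apply Nat.subtype_card
  intro P
  simp only [Finset.mem_image, Finset.mem_filter]
  constructor
  · rintro ⟨t, ⟨ht, hc⟩, rfl⟩
    refine ⟨⟨_, _, rfl⟩, ?_⟩
    rw [← hc]
    exact (face_preconnected _ _).subset_connectedComponentIn (ctr_mem t.1 t.2)
      ((face_subset_iff_disag hω t).2 ht)
  · rintro ⟨⟨x, i, rfl⟩, hP⟩
    obtain ⟨y, hy, rfl⟩ := hγ
    refine ⟨(x, i), ⟨?_, ?_⟩, rfl⟩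
    · exact (face_subset_iff_disag hω (x, i)).1 (hP.trans (connectedComponentIn_subset _ _))
    · exact (connectedComponentIn_eq (hP (ctr_mem x i))).symm

/-- contour representation of the Ising Boltzmann weight: for `ω ∈ Ω_Λ^+`,
`exp(-H_{Φ^β,Λ}(ω)) = e^{β|𝓔_Λ|} Π_{γ ∈ Γ(ω)} e^{-2β|γ|}`. -/
theorem ising_contour_representation (d : ℕ) (hd : 2 ≤ d) (β : ℝ) (hβ : 0 < β)
    (Λ : Finset (V d)) (ω : Config d) (hω : plusOutside Λ ω) :
    Real.exp (-(ham (ising β) Λ ω))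
      = Real.exp (β * (edgeCount Λ : ℝ)) *
        ∏ᶠ γ ∈ Gamma ω, Real.exp (-2*β*(csize γ : ℝ)) := by
  classical
  have hsub : ∀ t ∈ disag Λ ω, compOf ω t ∈ Gamma ω := fun t ht =>
    ⟨ctr t, (face_subset_iff_disag hω t).2 ht (ctr_mem t.1 t.2), rfl⟩
  rw [finprod_mem_eq_prod_of_inter_mulSupport_eq (t := (disag Λ ω).image (compOf ω)),
    ← Real.exp_sum, ← Real.exp_add, ham_eq, edgeCount_eq, ← Finset.mul_sum]
  · have hsum : ∑ γ ∈ (disag Λ ω).image (compOf ω), (csize γ : ℝ) = (disag Λ ω).card := by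
      rw [← Nat.cast_sum, Finset.card_eq_sum_card_image (compOf ω) (disag Λ ω)]
      congr 1
      refine Finset.sum_congr rfl fun γ hγ => ?_
      obtain ⟨t, ht, rfl⟩ := Finset.mem_image.1 hγ
      exact csize_eq hω (hsub t ht)
    rw [hsum]
    congr 1
    ring
  · ext γ
    simp only [Set.mem_inter_iff, Finset.coe_image, Set.mem_image, Finset.mem_coe]
    constructor
    · rintro ⟨h1, h2⟩
      refine ⟨?_, h2⟩
      by_contra hne
      apply h2
      dsimp only
      rw [csize_eq hω h1, Finset.filter_eq_empty_iff.2 (fun t ht hc => hne ⟨t, ht, hc⟩)]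
      simp
    · rintro ⟨⟨t, ht, rfl⟩, h2⟩
      exact ⟨hsub t ht, h2⟩

end
end Ising
end

section
/- Let d ≥ 2, let Λ ⋐ Z^d be c-connected, let ω ∈ Ω_Λ^+, and let γ ∈ Γ(ω). Let ω_γ be obtained from ω by flipping all spins in int γ. Then ω_γ ∈ Ω_Λ^+ and Γ(ω_γ) = Γ(ω) ∖ {γ}. -/
open scoped BigOperators
open Real MeasureTheory Filter Topology

namespace Ising

variable {d : ℕ}

noncomputable section

theorem cube_closed (x : V d) : IsClosed (cube x) := by
  have : cube x = ⋂ i, {y : Point d | |y i - (x i : ℝ)| ≤ 1/2} := by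
    ext y; simp [cube]
  rw [this]
  exact isClosed_iInter fun i => isClosed_le (by fun_prop) (by fun_prop)

theorem cube_convex (x : V d) : Convex ℝ (cube x) := by
  intro a ha b hb s t hs ht hst i
  have h1 := abs_le.1 (ha i)
  have h2 := abs_le.1 (hb i)
  simp only [Pi.add_apply, Pi.smul_apply, smul_eq_mul]
  have e : s * a i + t * b i - (x i : ℝ) = s * (a i - x i) + t * (b i - x i) := by
    have : (x i : ℝ) = (s + t) * x i := by rw [hst, one_mul]
    linear_combination -this
  rw [e, abs_le]
  constructor <;> nlinarith

theorem cube_cover (z : Point d) : ∃ x : V d, z ∈ cube x :=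
  ⟨fun i => round (z i), fun i => abs_sub_round (z i)⟩

theorem cubes_closed (A : Set (V d)) : IsClosed (cubes A) := by
  have hlf : LocallyFinite (fun x : V d => cube x) := by
    intro z
    refine ⟨Metric.ball z 1, Metric.ball_mem_nhds z one_pos, ?_⟩
    refine (Set.finite_Icc (fun i => ⌊z i⌋ - 2) (fun i => ⌈z i⌉ + 2)).subset ?_
    rintro x ⟨y, hy, hyz⟩
    have hd : ∀ i, |y i - z i| < 1 := by
      intro i
      have := dist_le_pi_dist y z i
      rw [Real.dist_eq] at this
      exact lt_of_le_of_lt this hyz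
    constructor
    · intro i
      have h1 := abs_le.1 (hy i)
      have h2 := abs_lt.1 (hd i)
      have h3 := Int.floor_le (z i)
      have : ((⌊z i⌋ - 2 : ℤ) : ℝ) ≤ (x i : ℝ) := by push_cast; linarith
      exact_mod_cast this
    · intro i
      have h1 := abs_le.1 (hy i)
      have h2 := abs_lt.1 (hd i)
      have h3 := Int.le_ceil (z i)
      have : (x i : ℝ) ≤ ((⌈z i⌉ + 2 : ℤ) : ℝ) := by push_cast; linarith
      exact_mod_cast this
  have : cubes A = ⋃ x : A, cube (x : V d) := by
    simp [cubes, Set.iUnion_subtype]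
  rw [this]
  exact (hlf.comp_injective Subtype.val_injective).isClosed_iUnion fun x => cube_closed _

theorem mem_cubes {A : Set (V d)} {z : Point d} : z ∈ cubes A ↔ ∃ x ∈ A, z ∈ cube x := by
  simp [cubes]

theorem closure_compl_cubes (A : Set (V d)) : closure (cubes A)ᶜ = cubes Aᶜ := by
  apply Set.Subset.antisymm
  · refine closure_minimal ?_ (cubes_closed _)
    intro z hz
    obtain ⟨x, hx⟩ := cube_cover z
    exact mem_cubes.2 ⟨x, fun hA => hz (mem_cubes.2 ⟨x, hA, hx⟩), hx⟩
  · intro z hz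
    obtain ⟨x, hxA, hx⟩ := mem_cubes.1 hz
    let g : ℝ → Point d := fun t i => z i + t * ((x i : ℝ) - z i)
    have hg : Continuous g := by fun_prop
    have h0 : g 0 = z := by funext i; simp [g]
    have ht : Tendsto g (𝓝[>] 0) (𝓝 z) := by
      have := hg.tendsto 0
      rw [h0] at this
      exact this.mono_left nhdsWithin_le_nhds
    refine mem_closure_of_tendsto ht ?_
    filter_upwards [Ioo_mem_nhdsGT (show (0:ℝ) < 1 by norm_num)] with t ht
    intro hmem
    obtain ⟨u, huA, hu⟩ := mem_cubes.1 hmem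
    have : u = x := by
      funext i
      have h1 := abs_le.1 (hx i)
      have h2 := abs_le.1 (hu i)
      simp only [g] at h2
      obtain ⟨t0, t1⟩ := ht
      have a1 : (u i : ℝ) - x i < 1 := by nlinarith
      have a2 : (x i : ℝ) - u i < 1 := by nlinarith
      have b1 : u i - x i < 1 := by exact_mod_cast a1
      have b2 : x i - u i < 1 := by exact_mod_cast a2
      omega
    exact hxA (this ▸ huA)

theorem mem_frontier_cubes {A : Set (V d)} {z : Point d} :
    z ∈ frontier (cubes A) ↔ (∃ x ∈ A, z ∈ cube x) ∧ (∃ x, x ∉ A ∧ z ∈ cube x) := by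
  rw [frontier_eq_closure_inter_closure, closure_compl_cubes, (cubes_closed A).closure_eq]
  simp only [Set.mem_inter_iff, mem_cubes, Set.mem_compl_iff]

theorem box_const (z : Point d) (P : V d → Prop)
    (h : ∀ x i b, z ∈ cube x → z ∈ cube (Function.update x i b) →
      (P x ↔ P (Function.update x i b)))
    (x y : V d) (hx : z ∈ cube x) (hy : z ∈ cube y) : P x ↔ P y := by
  have hm : ∀ s : Finset (Fin d), z ∈ cube (s.piecewise y x) := by
    intro s i
    by_cases hi : i ∈ s
    · simpa [hi] using hy i
    · simpa [hi] using hx i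
  have key : ∀ s : Finset (Fin d), P x ↔ P (s.piecewise y x) := by
    intro s
    induction s using Finset.induction_on with
    | empty => simp
    | insert j s hj ih =>
      rw [ih]
      have h2 := hm (insert j s)
      rw [Finset.piecewise_insert] at h2 ⊢
      exact h _ _ _ (hm s) h2
  have := key Finset.univ
  rwa [Finset.piecewise_univ] at this

/-- A point of the common face of two adjacent cubes lying in no other cube. -/
theorem face_center (x : V d) (i : Fin d) (b : ℤ) (z : Point d) (hx : z ∈ cube x)
    (hb : z ∈ cube (Function.update x i b)) :
    ∃ w, w ∈ cube x ∧ w ∈ cube (Function.update x i b) ∧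
      ∀ u, w ∈ cube u → u = x ∨ u = Function.update x i b := by
  have h1 := abs_le.1 (hx i)
  have h2 := abs_le.1 (hb i)
  simp only [Function.update_self] at h2
  have a1 : (x i : ℝ) - b ≤ 1 := by linarith
  have a2 : (b : ℝ) - x i ≤ 1 := by linarith
  have b1 : x i - b ≤ 1 := by exact_mod_cast a1
  have b2 : b - x i ≤ 1 := by exact_mod_cast a2
  refine ⟨Function.update (fun j => (x j : ℝ)) i (((x i : ℝ) + b) / 2), ?_, ?_, ?_⟩
  · intro j
    by_cases hj : j = i
    · subst hj
      simp only [Function.update_self]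
      rw [abs_le]; constructor <;> linarith
    · simp [hj]
  · intro j
    by_cases hj : j = i
    · subst hj
      simp only [Function.update_self]
      rw [abs_le]; constructor <;> linarith
    · simp [hj]
  · intro u hu
    have hne : ∀ j, j ≠ i → u j = x j := by
      intro j hj
      have h := abs_le.1 (hu j)
      simp only [Function.update_of_ne hj] at h
      have c1 : (x j : ℝ) - u j < 1 := by linarith
      have c2 : (u j : ℝ) - x j < 1 := by linarith
      have d1 : x j - u j < 1 := by exact_mod_cast c1
      have d2 : u j - x j < 1 := by exact_mod_cast c2
      omega
    have h := abs_le.1 (hu i)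
    simp only [Function.update_self] at h
    have c1 : (x i : ℝ) + b - 2 * u i ≤ 1 := by linarith
    have c2 : 2 * (u i : ℝ) - x i - b ≤ 1 := by linarith
    have d1 : x i + b - 2 * u i ≤ 1 := by exact_mod_cast c1
    have d2 : 2 * u i - x i - b ≤ 1 := by exact_mod_cast c2
    have : u i = x i ∨ u i = b := by omega
    rcases this with h | h
    · left
      funext j
      by_cases hj : j = i
      · rw [hj, h]
      · exact hne j hj
    · right
      funext j
      by_cases hj : j = i
      · subst hj; simp [h]
      · simp [hj, hne j hj]

theorem differ_of_frontier {A : Set (V d)} {w : Point d} {x x' : V d}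
    (hw : w ∈ frontier (cubes A)) (hu : ∀ u, w ∈ cube u → u = x ∨ u = x') :
    ¬ (x ∈ A ↔ x' ∈ A) := by
  obtain ⟨⟨a, ha, haw⟩, b, hb, hbw⟩ := mem_frontier_cubes.1 hw
  rcases hu a haw with rfl | rfl <;> rcases hu b hbw with rfl | rfl <;> tauto

theorem frontier_of_differ {A : Set (V d)} {w : Point d} {x x' : V d}
    (hx : w ∈ cube x) (hx' : w ∈ cube x') (h : ¬ (x ∈ A ↔ x' ∈ A)) :
    w ∈ frontier (cubes A) := by
  rw [mem_frontier_cubes]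
  by_cases h1 : x ∈ A
  · exact ⟨⟨x, h1, hx⟩, x', by tauto, hx'⟩
  · exact ⟨⟨x', by tauto, hx'⟩, x, h1, hx⟩

/-- Near a point of a component `∂M(S)` of `∂M(A)`, the sets `A` and `S` agree
up to complementation. -/
theorem local_agree {A S : Set (V d)} {y z : Point d}
    (hγ : frontier (cubes S) = connectedComponentIn (frontier (cubes A)) y)
    (hz : z ∈ frontier (cubes S)) (x x' : V d) (hx : z ∈ cube x) (hx' : z ∈ cube x') :
    (x ∈ A ↔ x ∈ S) ↔ (x' ∈ A ↔ x' ∈ S) := by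
  refine box_const z (fun x => (x ∈ A ↔ x ∈ S)) ?_ x x' hx hx'
  clear hx hx' x x'
  intro x i b hx hb
  have hsub : frontier (cubes S) ⊆ frontier (cubes A) := by
    rw [hγ]; exact connectedComponentIn_subset _ _
  obtain ⟨w, hw1, hw2, hw⟩ := face_center x i b z hx hb
  have key : (x ∈ A ↔ Function.update x i b ∈ A) ↔ (x ∈ S ↔ Function.update x i b ∈ S) := by
    rw [← not_iff_not]
    constructor
    · intro hA
      have hpre : IsPreconnected (cube x ∩ cube (Function.update x i b)) :=
        ((cube_convex x).inter (cube_convex _)).isPreconnected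
      have hs : cube x ∩ cube (Function.update x i b) ⊆ frontier (cubes A) :=
        fun u hu => frontier_of_differ hu.1 hu.2 hA
      have h1 := hpre.subset_connectedComponentIn ⟨hx, hb⟩ hs
      have h2 : connectedComponentIn (frontier (cubes A)) y =
          connectedComponentIn (frontier (cubes A)) z :=
        connectedComponentIn_eq (hγ ▸ hz)
      rw [← h2, ← hγ] at h1
      exact differ_of_frontier (h1 ⟨hw1, hw2⟩) hw
    · intro hS
      exact differ_of_frontier (hsub (frontier_of_differ hw1 hw2 hS)) hw
  show (x ∈ A ↔ x ∈ S) ↔ _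
  tauto

theorem mem_minus_flip (S : Finset (V d)) (ω : Config d) (x : V d) :
    x ∈ minusSet (flipOn S ω) ↔ ¬ (x ∈ minusSet ω ↔ x ∈ (↑S : Set (V d))) := by
  by_cases h : x ∈ S <;> cases hω : ω x <;> simp [minusSet, flipOn, h, hω]

theorem frontier_flip {A S B : Set (V d)} {y : Point d}
    (hγ : frontier (cubes S) = connectedComponentIn (frontier (cubes A)) y)
    (hB : ∀ x, x ∈ B ↔ ¬ (x ∈ A ↔ x ∈ S)) :
    frontier (cubes B) = frontier (cubes A) \ frontier (cubes S) := by
  ext z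
  by_cases hz : z ∈ frontier (cubes S)
  · simp only [Set.mem_diff, hz, not_true_eq_false, and_false, iff_false]
    intro h
    obtain ⟨⟨a, ha, haz⟩, b, hb, hbz⟩ := mem_frontier_cubes.1 h
    have := local_agree hγ hz a b haz hbz
    rw [hB] at ha hb
    tauto
  · simp only [Set.mem_diff, hz, not_false_eq_true, and_true]
    have hS : ∀ a b, z ∈ cube a → z ∈ cube b → (a ∈ S ↔ b ∈ S) := by
      intro a b ha hb
      by_contra hne
      exact hz (frontier_of_differ ha hb hne)
    constructor
    · intro h
      obtain ⟨⟨a, ha, haz⟩, b, hb, hbz⟩ := mem_frontier_cubes.1 h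
      have := hS a b haz hbz
      rw [hB] at ha hb
      exact frontier_of_differ haz hbz (by tauto)
    · intro h
      obtain ⟨⟨a, ha, haz⟩, b, hb, hbz⟩ := mem_frontier_cubes.1 h
      have := hS a b haz hbz
      refine frontier_of_differ haz hbz ?_
      rw [hB, hB]
      tauto

/-- Removing a connected component removes exactly that component. -/
theorem component_diff {X : Type*} [TopologicalSpace X] {F : Set X} {y z : X}
    (hz : z ∈ F \ connectedComponentIn F y) :
    connectedComponentIn (F \ connectedComponentIn F y) z = connectedComponentIn F z := by
  apply Set.Subset.antisymm
  · exact connectedComponentIn_mono z Set.diff_subset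
  · refine isPreconnected_connectedComponentIn.subset_connectedComponentIn
      (mem_connectedComponentIn hz.1) ?_
    intro u hu
    refine ⟨connectedComponentIn_subset _ _ hu, fun hu' => hz.2 ?_⟩
    rw [connectedComponentIn_eq hu', ← connectedComponentIn_eq hu]
    exact mem_connectedComponentIn hz.1

theorem common_point {a b : V d} (h : distInf a b = 1) : ∃ z, z ∈ cube a ∧ z ∈ cube b := by
  have hi : ∀ i, |(a i : ℝ) - b i| ≤ 1 := by
    intro i
    have h1 : (a i - b i).natAbs ≤ 1 := by
      rw [← h]
      exact Finset.le_sup (f := fun i => (a i - b i).natAbs) (Finset.mem_univ i)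
    have h2 : |a i - b i| ≤ 1 := by rw [abs_le]; omega
    exact_mod_cast h2
  refine ⟨fun i => ((a i : ℝ) + b i) / 2, fun i => ?_, fun i => ?_⟩ <;>
  · have := abs_le.1 (hi i)
    rw [abs_le]
    constructor <;> linarith

theorem exists_step {P : ℕ → Prop} {n : ℕ} (h0 : P 0) (hn : ¬ P n) :
    ∃ i < n, P i ∧ ¬ P (i + 1) := by
  by_contra hc
  push Not at hc
  have : ∀ i ≤ n, P i := by
    intro i
    induction i with
    | zero => intro _; exact h0
    | succ k ih => intro hk; exact hc k hk (ih (by omega))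
  exact hn (this n le_rfl)

/-- for c-connected `Λ`, `ω ∈ Ω_Λ^+` and `γ ∈ Γ(ω)` (with interior `S`),
flipping the spins in the interior of `γ` stays in `Ω_Λ^+` and removes exactly the
contour `γ`: `Γ(ω_γ) = Γ(ω) ∖ {γ}`. -/
theorem flip_removes_contour (d : ℕ) (hd : 2 ≤ d)
    (Λ : Finset (V d)) (hΛ : CConn Λ) (ω : Config d) (hω : plusOutside Λ ω)
    (S : Finset (V d)) (hS : CConn S)
    (hγ : frontier (cubes (↑S : Set (V d))) ∈ Gamma ω) :
    plusOutside Λ (flipOn S ω) ∧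
    Gamma (flipOn S ω) = Gamma ω \ {frontier (cubes (↑S : Set (V d)))} := by
  obtain ⟨y, hy, hγ⟩ := hγ
  have hfr := frontier_flip hγ (mem_minus_flip S ω)
  constructor
  · have hSΛ : ∀ x ∈ S, x ∈ Λ := by
      intro x hxS
      by_contra hxΛ
      haveI : Nonempty (Fin d) := ⟨⟨0, by omega⟩⟩
      obtain ⟨v, hv⟩ := Infinite.exists_notMem_finset (Λ ∪ S)
      rw [Finset.mem_union, not_or] at hv
      obtain ⟨n, p, hp0, hpn, hpm, hps⟩ := hΛ.2 x (by simpa using hxΛ) v (by simpa using hv.1)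
      obtain ⟨i, hi, hiS, hiS'⟩ := exists_step (P := fun i => p i ∈ S) (n := n)
        (by simpa [hp0] using hxS) (by simpa [hpn] using hv.2)
      obtain ⟨z, hz, hz'⟩ := common_point (hps i hi)
      have hzγ : z ∈ frontier (cubes (↑S : Set (V d))) := by
        refine frontier_of_differ hz hz' ?_
        simp [hiS, hiS']
      have := local_agree hγ hzγ _ _ hz hz'
      have h1 := hω _ (by simpa using hpm i hi.le)
      have h2 := hω _ (by simpa using hpm (i + 1) hi)
      simp [minusSet, h1, h2, hiS, hiS'] at this
    intro x hx
    have : x ∉ S := fun h => hx (hSΛ x h)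
    simp [flipOn, this, hω x hx]
  · rw [hγ] at hfr ⊢
    ext c
    simp only [Gamma, Set.mem_setOf_eq, Set.mem_diff, Set.mem_singleton_iff]
    rw [hfr]
    constructor
    · rintro ⟨z, hz, rfl⟩
      rw [component_diff hz]
      refine ⟨⟨z, hz.1, rfl⟩, fun h => hz.2 ?_⟩
      rw [← h]
      exact mem_connectedComponentIn hz.1
    · rintro ⟨⟨z, hz, rfl⟩, hne⟩
      have hz' : z ∈ frontier (cubes (minusSet ω)) \
          connectedComponentIn (frontier (cubes (minusSet ω))) y :=
        ⟨hz, fun h => hne (connectedComponentIn_eq h).symm⟩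
      exact ⟨z, hz', (component_diff hz').symm⟩

end
end Ising
end

section
/- Let d ≥ 1, F a finite set, Ω = F^{Z^d}, and let Φ_0 be a translation invariant, absolutely summable interaction. Let I be the set of translation invariant Borel probability measures on Ω and I_{Φ_0} the set of equilibrium states for Φ_0. Then for every weak*-open neighborhood U of I_{Φ_0} in I there exists 0 < δ < 1 such that for every translation invariant interaction Ψ with ‖Ψ‖ < δ, every equilibrium state of Φ_0 + Ψ lies in U, i.e. I_{Φ_0+Ψ} ⊆ U. -/
open Real MeasureTheory Filter Topology

namespace LatticeF

/-- The lattice `ℤ^d`. -/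
abbrev V (d : ℕ) := Fin d → ℤ

variable {d : ℕ} {F : Type*}

noncomputable section

/-- An interaction assigns to each finite `Λ ⊆ ℤ^d` a function of configurations
(only the restriction to `Λ` is relevant; see `IsLocal`). -/
abbrev Interaction (d : ℕ) (F : Type*) := Finset (V d) → (V d → F) → ℝ

/-- `Φ_Λ` depends only on the restriction of the configuration to `Λ`. -/
def IsLocal (Φ : Interaction d F) : Prop :=
  ∀ (Λ : Finset (V d)) (ω ω' : V d → F), (∀ x ∈ Λ, ω x = ω' x) → Φ Λ ω = Φ Λ ω'

/-- Translation of a configuration: `(τ^a ω)(x) = ω(x+a)`. -/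
def translate (a : V d) (ω : V d → F) : V d → F := fun x => ω (x + a)

/-- Translation invariance of an interaction: `Φ_Λ(ω) = Φ_{Λ-a}(τ^a ω)`. -/
def TransInv (Φ : Interaction d F) : Prop :=
  ∀ (a : V d) (Λ : Finset (V d)) (ω : V d → F),
    Φ (Λ.image (fun x => x - a)) (translate a ω) = Φ Λ ω

/-- `sup_{ω ∈ Ω_Λ} |Φ_Λ(ω)|`. -/
def supNorm [Nonempty F] (Φ : Interaction d F) (Λ : Finset (V d)) : ℝ :=
  ⨆ ω : V d → F, |Φ Λ ω|

/-- The summand of the norm `‖Φ‖`. -/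
def normTerm [Nonempty F] (Φ : Interaction d F) (Λ : Finset (V d)) : ℝ :=
  if (0 : V d) ∈ Λ then supNorm Φ Λ else 0

/-- `‖Φ‖ = Σ_{0 ∈ Λ ⋐ ℤ^d} sup_{ω} |Φ_Λ(ω)|`. -/
def anorm [Nonempty F] (Φ : Interaction d F) : ℝ := ∑' Λ : Finset (V d), normTerm Φ Λ

/-- Absolute summability of an interaction. -/
def AbsSummable [Nonempty F] (Φ : Interaction d F) : Prop := Summable (normTerm Φ)

/-- The box `B(n) = {-n, …, n}^d`. -/
def B (d n : ℕ) : Finset (V d) := Finset.Icc (fun _ => -(n : ℤ)) (fun _ => (n : ℤ))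

/-- `μ_Λ({f}) = μ({ξ : ξ|_Λ = f})`. -/
def cylProb [MeasurableSpace F] (μ : Measure (V d → F)) (Λ : Finset (V d))
    (f : ↥Λ → F) : ℝ :=
  (μ {ξ | ∀ (x : V d) (h : x ∈ Λ), ξ x = f ⟨x, h⟩}).toReal

/-- The measure-theoretic entropy
`h(μ) = lim_n -(1/|B(n)|) Σ_ω μ_{B(n)}({ω}) log μ_{B(n)}({ω})`. -/
def entropy [Fintype F] [MeasurableSpace F] (μ : Measure (V d → F)) : ℝ :=
  limUnder atTop (fun n : ℕ =>
    -(1 / ((B d n).card : ℝ)) *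
      ∑ f : ↥(B d n) → F, cylProb μ (B d n) f * Real.log (cylProb μ (B d n) f))

/-- The lexicographic order on `ℤ^d`. -/
def lexLt (x y : V d) : Prop := toLex x < toLex y

open scoped Classical in
/-- `0` belongs to `Λ` and is its `⌊(|Λ|+1)/2⌋`-th element in the lexicographic order. -/
def IsMid (Λ : Finset (V d)) : Prop :=
  (0 : V d) ∈ Λ ∧ (Λ.filter fun y => lexLt y 0).card + 1 = (Λ.card + 1) / 2

open scoped Classical in
/-- `A_Φ(ω) = -Σ_Λ Φ_Λ(ω|_Λ)`, summed over those `Λ ∋ 0` for which `0` is the middle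
element of `Λ` in the lexicographic order. -/
def AFn (Φ : Interaction d F) (ω : V d → F) : ℝ :=
  -∑' Λ : Finset (V d), if IsMid Λ then Φ Λ ω else 0

/-- A fixed configuration used to extend local configurations. -/
def junkCfg [Nonempty F] : V d → F := fun _ => Classical.arbitrary F

/-- The configuration agreeing with `f` on `Λ` and with `η` off `Λ`. -/
def fill (Λ : Finset (V d)) (f : ↥Λ → F) (η : V d → F) : V d → F :=
  fun x => if h : x ∈ Λ then f ⟨x, h⟩ else η x

/-- The partition function with free boundary condition
`Z_{Φ,Λ} = Σ_{ω ∈ Ω_Λ} exp(-Σ_{Δ ⊆ Λ} Φ_Δ(ω|_Δ))`. -/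
def freeZ [Nonempty F] [Fintype F] (Φ : Interaction d F) (Λ : Finset (V d)) : ℝ :=
  ∑ f : ↥Λ → F, Real.exp (-(∑ Δ ∈ Λ.powerset, Φ Δ (fill Λ f junkCfg)))

/-- The pressure `P^Φ = lim_n (1/|B(n)|) log Z_{Φ,B(n)}`. -/
def pressure [Nonempty F] [Fintype F] (Φ : Interaction d F) : ℝ :=
  limUnder atTop (fun n : ℕ => (1 / ((B d n).card : ℝ)) * Real.log (freeZ Φ (B d n)))

/-- Translation invariance of a measure: `τ^a_* μ = μ`. -/
def MeasTransInv [MeasurableSpace F] (μ : Measure (V d → F)) : Prop :=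
  ∀ a : V d, μ.map (translate a) = μ

/-- `μ` is an equilibrium state for `Φ`: `μ` is a translation invariant Borel probability
measure attaining the supremum `h(μ) + ∫ A_Φ dμ = P^Φ` of the variational principle. -/
def IsEquilibrium [Nonempty F] [Fintype F] [MeasurableSpace F] (Φ : Interaction d F)
    (μ : Measure (V d → F)) : Prop :=
  IsProbabilityMeasure μ ∧ MeasTransInv μ ∧
    entropy μ + ∫ ω, AFn Φ ω ∂μ = pressure Φ

/-- The sum of two interactions. -/
def Iadd (Φ Ψ : Interaction d F) : Interaction d F := fun Λ ω => Φ Λ ω + Ψ Λ ω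


/-! ### Boxes -/

lemma mem_B {d n : ℕ} {x : V d} : x ∈ B d n ↔ ∀ i, -(n : ℤ) ≤ x i ∧ x i ≤ n := by
  simp only [B, Finset.mem_Icc, Pi.le_def]
  exact ⟨fun h i => ⟨h.1 i, h.2 i⟩, fun h => ⟨fun i => (h i).1, fun i => (h i).2⟩⟩

lemma card_B (d n : ℕ) : (B d n).card = (2 * n + 1) ^ d := by
  have : ((n : ℤ) + 1 + (n : ℤ)).toNat = 2 * n + 1 := by omega
  simp [B, Pi.card_Icc, this]

lemma card_B_pos (d n : ℕ) : (0 : ℝ) < ((B d n).card : ℝ) := by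
  rw [card_B]; positivity

lemma B_mono (d : ℕ) {m n : ℕ} (h : m ≤ n) : B d m ⊆ B d n := by
  intro x hx
  rw [mem_B] at *
  intro i
  have := hx i
  omega

lemma exists_B_subset (d : ℕ) (s : Finset (V d)) : ∃ r, s ⊆ B d r := by
  refine ⟨∑ x ∈ s, ∑ i, (x i).natAbs, fun x hx => ?_⟩
  rw [mem_B]
  intro i
  have h1 : (x i).natAbs ≤ ∑ i, (x i).natAbs :=
    Finset.single_le_sum (f := fun i => (x i).natAbs) (fun _ _ => Nat.zero_le _) (Finset.mem_univ i)
  have h2 : ∑ i, (x i).natAbs ≤ ∑ x ∈ s, ∑ i, (x i).natAbs :=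
    Finset.single_le_sum (f := fun x : V d => ∑ i, (x i).natAbs) (fun _ _ => Nat.zero_le _) hx
  omega

/-- proportion of the boundary shell -/
def rho (d r m : ℕ) : ℝ := ((B d m \ B d (m - r)).card : ℝ) / ((B d m).card : ℝ)

lemma rho_nonneg (d r m : ℕ) : 0 ≤ rho d r m := by unfold rho; positivity

lemma rho_eq (d r m : ℕ) : rho d r m = 1 - ((B d (m - r)).card : ℝ) / ((B d m).card : ℝ) := by
  have h := Finset.card_sdiff_add_card_eq_card (B_mono d (Nat.sub_le m r))
  have h' : ((B d m \ B d (m - r)).card : ℝ) + ((B d (m-r)).card : ℝ) = ((B d m).card : ℝ) := by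
    exact_mod_cast h
  have := card_B_pos d m
  unfold rho
  field_simp
  linarith

lemma tendsto_rho (d r : ℕ) : Tendsto (rho d r) atTop (𝓝 0) := by
  have h1 : Tendsto (fun m : ℕ => (2 * (r : ℝ)) / (2 * (m : ℝ) + 1)) atTop (𝓝 0) := by
    apply Tendsto.div_atTop tendsto_const_nhds
    apply tendsto_atTop_add_const_right
    exact Tendsto.const_mul_atTop (by norm_num) tendsto_natCast_atTop_atTop
  have h2 : Tendsto (fun m : ℕ => 1 - (1 - (2 * (r : ℝ)) / (2 * (m : ℝ) + 1)) ^ d) atTop (𝓝 0) := by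
    have := ((h1.const_sub 1).pow d).const_sub 1
    simpa using this
  refine h2.congr' ?_
  filter_upwards [eventually_ge_atTop r] with m hm
  rw [rho_eq, card_B, card_B]
  push_cast [Nat.cast_sub hm]
  rw [← div_pow]
  congr 2
  field_simp
  ring

/-- tiles -/
def tile (d n : ℕ) (z : V d) : Finset (V d) :=
  (B d n).image (fun x => x + (2 * (n : ℤ) + 1) • z)

lemma mem_tile {d n : ℕ} {z x : V d} :
    x ∈ tile d n z ↔ ∀ i, z i = (x i + n) / (2 * (n : ℤ) + 1) := by
  have key : x ∈ tile d n z ↔ ∀ i, -(n : ℤ) ≤ x i - (2 * (n : ℤ) + 1) * z i ∧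
      x i - (2 * (n : ℤ) + 1) * z i ≤ n := by
    simp only [tile, Finset.mem_image, mem_B]
    constructor
    · rintro ⟨y, hy, rfl⟩ i
      simpa using hy i
    · intro h
      exact ⟨x - (2 * (n : ℤ) + 1) • z, fun i => by simpa using h i, by simp⟩
  rw [key]
  refine forall_congr' fun i => ?_
  have hs : (0 : ℤ) < 2 * (n : ℤ) + 1 := by positivity
  rw [eq_comm, Int.ediv_eq_iff_of_pos hs]
  constructor
  · rintro ⟨h1, h2⟩
    constructor <;> nlinarith
  · rintro ⟨h1, h2⟩
    constructor <;> nlinarith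

lemma tile_disjoint {d n : ℕ} {z w : V d} (h : z ≠ w) : Disjoint (tile d n z) (tile d n w) := by
  rw [Finset.disjoint_left]
  intro x hx hy
  rw [mem_tile] at hx hy
  exact h (funext fun i => (hx i).trans (hy i).symm)

lemma biUnion_tile (d n q : ℕ) :
    (B d q).biUnion (tile d n) = B d ((2 * n + 1) * q + n) := by
  ext x
  have hs : (0 : ℤ) < 2 * (n : ℤ) + 1 := by positivity
  have key : x ∈ (B d q).biUnion (tile d n) ↔
      (fun i => (x i + n) / (2 * (n : ℤ) + 1)) ∈ B d q := by
    rw [Finset.mem_biUnion]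
    constructor
    · rintro ⟨z, hz, hx⟩
      rw [mem_tile] at hx
      rwa [← (funext hx : z = _)]
    · intro h
      exact ⟨_, h, mem_tile.2 fun i => rfl⟩
  rw [key, mem_B, mem_B]
  refine forall_congr' fun i => ?_
  rw [Int.le_ediv_iff_mul_le hs, ← Int.lt_add_one_iff (b := (q : ℤ)), Int.ediv_lt_iff_lt_mul hs]
  push_cast
  constructor
  · rintro ⟨h1, h2⟩
    constructor <;> nlinarith
  · rintro ⟨h1, h2⟩
    constructor <;> nlinarith

/-- Multidimensional approximate Fekete lemma. -/
lemma fekete {d : ℕ} (S T : Finset (V d) → ℝ) (C : ℝ) (hC : 0 ≤ C)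
    (hsub : ∀ Λ₁ Λ₂, Disjoint Λ₁ Λ₂ → S (Λ₁ ∪ Λ₂) ≤ S Λ₁ + T Λ₂)
    (h0 : S ∅ ≤ 0)
    (hinv : ∀ (a : V d) Λ, T (Λ.image (fun x => x + a)) ≤ T Λ)
    (hT : ∀ Λ, T Λ ≤ C * (Λ.card : ℝ))
    (hS : ∀ Λ, -(C * (Λ.card : ℝ)) ≤ S Λ)
    (hST : ∀ Λ, S Λ ≤ T Λ)
    (hlim : Tendsto (fun n => (T (B d n) - S (B d n)) / ((B d n).card : ℝ)) atTop (𝓝 0)) :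
    ∃ ℓ : ℝ, Tendsto (fun n => S (B d n) / ((B d n).card : ℝ)) atTop (𝓝 ℓ) ∧
      ∀ n, ℓ ≤ T (B d n) / ((B d n).card : ℝ) := by
  set t : ℕ → ℝ := fun n => T (B d n) / ((B d n).card : ℝ) with ht
  set a : ℕ → ℝ := fun n => S (B d n) / ((B d n).card : ℝ) with ha
  have tiles : ∀ (n : ℕ) (Z : Finset (V d)),
      S (Z.biUnion (tile d n)) ≤ (Z.card : ℝ) * T (B d n) := by
    intro n Z
    induction Z using Finset.induction_on with
    | empty => simpa using h0
    | insert z Z hz ih =>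
      rw [Finset.biUnion_insert, Finset.union_comm, Finset.card_insert_of_notMem hz]
      have hd : Disjoint (Z.biUnion (tile d n)) (tile d n z) := by
        rw [Finset.disjoint_biUnion_left]
        intro w hw
        exact tile_disjoint (fun h => hz (h ▸ hw))
      have := hsub _ _ hd
      have h2 : T (tile d n z) ≤ T (B d n) := hinv _ _
      push_cast
      linarith
  have main : ∀ n m, n ≤ m → a m ≤ t n + (|t n| + C) * rho d (2 * n + 1) m := by
    intro n m hnm
    set q := (m - n) / (2 * n + 1) with hq
    have hq1 : (2 * n + 1) * q + n ≤ m := by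
      have := Nat.mul_div_le (m - n) (2 * n + 1)
      rw [← hq] at this
      omega
    have hq2 : m - (2 * n + 1) ≤ (2 * n + 1) * q + n := by
      have := Nat.lt_mul_div_succ (m - n) (show 0 < 2 * n + 1 by omega)
      rw [← hq] at this
      have e : (2 * n + 1) * (q + 1) = (2 * n + 1) * q + (2 * n + 1) := by ring
      omega
    set p := (2 * n + 1) * q + n with hp
    have hsubs := B_mono d hq1
    have h1 : S (B d m) ≤ S (B d p) + T (B d m \ B d p) := by
      have := hsub (B d p) (B d m \ B d p) Finset.disjoint_sdiff
      rwa [Finset.union_sdiff_of_subset hsubs] at this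
    have h2 : S (B d p) ≤ ((B d q).card : ℝ) * T (B d n) := by
      have := tiles n (B d q)
      rwa [biUnion_tile] at this
    have hcard : ((B d q).card : ℝ) * ((B d n).card : ℝ) = ((B d p).card : ℝ) := by
      rw [card_B, card_B, card_B, hp]
      push_cast
      rw [← mul_pow]
      congr 1
      ring
    have h3 : T (B d m \ B d p) ≤ C * ((B d m \ B d (m - (2 * n + 1))).card : ℝ) := by
      refine (hT _).trans (mul_le_mul_of_nonneg_left ?_ hC)
      exact_mod_cast Finset.card_le_card (Finset.sdiff_subset_sdiff le_rfl (B_mono d hq2))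
    have hm := card_B_pos d m
    have hn := card_B_pos d n
    have h4 : ((B d q).card : ℝ) * T (B d n) = ((B d p).card : ℝ) * t n := by
      rw [← hcard, ht]
      field_simp
    have h5 : a m ≤ (((B d p).card : ℝ) / ((B d m).card : ℝ)) * t n + C * rho d (2 * n + 1) m := by
      rw [ha, rho]
      simp only
      rw [div_le_iff₀ hm]
      have e : ((((B d p).card : ℝ) / ((B d m).card : ℝ)) * t n +
        C * (((B d m \ B d (m - (2 * n + 1))).card : ℝ) / ((B d m).card : ℝ))) *
          ((B d m).card : ℝ) = ((B d p).card : ℝ) * t n +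
            C * ((B d m \ B d (m - (2 * n + 1))).card : ℝ) := by
        field_simp
      rw [e]
      linarith
    set u := ((B d p).card : ℝ) / ((B d m).card : ℝ) with hu
    have hu1 : u ≤ 1 := by
      rw [hu, div_le_one hm]
      exact_mod_cast Finset.card_le_card hsubs
    have hu2 : 1 - rho d (2 * n + 1) m ≤ u := by
      rw [rho_eq, hu]
      have : ((B d (m - (2 * n + 1))).card : ℝ) ≤ ((B d p).card : ℝ) := by
        exact_mod_cast Finset.card_le_card (B_mono d hq2)
      have := div_le_div_of_nonneg_right this hm.le
      linarith
    have h6 : u * t n - t n ≤ |t n| * rho d (2 * n + 1) m := by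
      have : (1 - u) * (-(t n)) ≤ rho d (2 * n + 1) m * |t n| :=
        (mul_le_mul_of_nonneg_left (neg_le_abs (t n)) (by linarith)).trans
              (mul_le_mul_of_nonneg_right (by linarith) (abs_nonneg _))
      nlinarith
    nlinarith
  have hbdd : BddBelow (Set.range t) := by
    refine ⟨-C, ?_⟩
    rintro _ ⟨n, rfl⟩
    rw [ht]
    simp only
    rw [le_div_iff₀ (card_B_pos d n)]
    linarith [hS (B d n), hST (B d n)]
  have hle : ∀ n, sInf (Set.range t) ≤ t n := fun n => csInf_le hbdd ⟨n, rfl⟩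
  refine ⟨sInf (Set.range t), ?_, hle⟩
  rw [Metric.tendsto_atTop']
  intro ε hε
  obtain ⟨_, ⟨n, rfl⟩, hn⟩ := Real.lt_sInf_add_pos (Set.range_nonempty t) (half_pos hε)
  have hr : Tendsto (fun m => (|t n| + C) * rho d (2 * n + 1) m) atTop (𝓝 0) := by
    simpa using (tendsto_rho d (2 * n + 1)).const_mul (|t n| + C)
  have e1 := hr.eventually (gt_mem_nhds (half_pos hε))
  have e2 := hlim.eventually (gt_mem_nhds hε)
  obtain ⟨N, hN⟩ := eventually_atTop.1 (e1.and (e2.and (eventually_ge_atTop n)))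
  refine ⟨N, fun m hm => ?_⟩
  obtain ⟨k1, k2, k3⟩ := hN m hm.le
  have := main n m k3
  have h7 := hle m
  rw [sub_div] at k2
  change t m - a m < ε at k2
  rw [Real.dist_eq, abs_lt]
  change -ε < a m - _ ∧ a m - _ < ε
  constructor <;> linarith

/-! ### Shannon entropy -/

lemma gibbs_ineq {ι : Type*} [Fintype ι] (p q : ι → ℝ) (hp : ∀ i, 0 ≤ p i)
    (hp1 : ∑ i, p i = 1) (hq : ∀ i, 0 ≤ q i) (hq1 : ∑ i, q i ≤ 1)
    (hpq : ∀ i, q i = 0 → p i = 0) :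
    ∑ i, Real.negMulLog (p i) ≤ -∑ i, p i * Real.log (q i) := by
  have key : ∀ i, Real.negMulLog (p i) + p i * Real.log (q i) ≤ q i - p i := by
    intro i
    rcases (hp i).eq_or_lt with h | h
    · rw [← h]
      simpa using hq i
    · have hqi : 0 < q i := by
        refine lt_of_le_of_ne (hq i) (fun h' => ?_)
        have := hpq i h'.symm
        linarith
      have h1 := Real.log_le_sub_one_of_pos (div_pos hqi h)
      rw [Real.log_div hqi.ne' h.ne'] at h1
      have h2 := mul_le_mul_of_nonneg_left h1 h.le
      have h3 : p i * (q i / p i - 1) = q i - p i := by field_simp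
      rw [Real.negMulLog]
      linarith
  have := Finset.sum_le_sum (fun i (_ : i ∈ Finset.univ) => key i)
  rw [Finset.sum_add_distrib, Finset.sum_sub_distrib] at this
  linarith

lemma sum_inj_le {α β : Type*} [Fintype α] [Fintype β] (g : α → β) (hg : Function.Injective g)
    (u : β → ℝ) (hu : ∀ b, 0 ≤ u b) : ∑ a, u (g a) ≤ ∑ b, u b := by
  classical
  rw [← Finset.sum_image (f := u) (s := Finset.univ) (g := g) (fun a _ b _ h => hg h)]
  exact Finset.sum_le_sum_of_subset_of_nonneg (Finset.subset_univ _) (fun b _ _ => hu b)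

/-- restriction to a smaller set -/
def rs {Λ Λ' : Finset (V d)} (h : Λ ⊆ Λ') (f : ↥Λ' → F) : ↥Λ → F := fun x => f ⟨x, h x.2⟩

lemma sum_prod_le [Fintype F] (Λ₁ Λ₂ : Finset (V d)) (u : (↥Λ₁ → F) → ℝ) (v : (↥Λ₂ → F) → ℝ)
    (hu : ∀ f, 0 ≤ u f) (hv : ∀ f, 0 ≤ v f) :
    ∑ f : ↥(Λ₁ ∪ Λ₂) → F, u (rs Finset.subset_union_left f) * v (rs Finset.subset_union_right f)
      ≤ (∑ f, u f) * ∑ f, v f := by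
  classical
  rw [Finset.sum_mul_sum, ← Fintype.sum_prod_type']
  refine sum_inj_le (fun f : ↥(Λ₁ ∪ Λ₂) → F =>
    ((rs Finset.subset_union_left f : ↥Λ₁ → F), (rs Finset.subset_union_right f : ↥Λ₂ → F)))
    ?_ (fun b => u b.1 * v b.2) (fun b => mul_nonneg (hu _) (hv _))
  intro f g h
  simp only [Prod.mk.injEq] at h
  funext ⟨x, hx⟩
  rcases Finset.mem_union.1 hx with h1 | h1
  · exact congrFun h.1 ⟨x, h1⟩
  · exact congrFun h.2 ⟨x, h1⟩

section Ent
variable [Fintype F] [MeasurableSpace F] [MeasurableSingletonClass F]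

/-- Shannon entropy of the marginal. -/
def Hent (μ : Measure (V d → F)) (Λ : Finset (V d)) : ℝ :=
  ∑ f : ↥Λ → F, Real.negMulLog (cylProb μ Λ f)

lemma cylProb_eq (μ : Measure (V d → F)) (Λ : Finset (V d)) (f : ↥Λ → F) :
    cylProb μ Λ f = μ.real (Λ.restrict ⁻¹' {f}) := by
  unfold cylProb Measure.real
  congr 2
  ext ξ
  simp only [Set.mem_ofPred_eq, Set.mem_preimage, Set.mem_singleton_iff, funext_iff,
    Finset.restrict, Subtype.forall]

lemma cylProb_nonneg (μ : Measure (V d → F)) (Λ : Finset (V d)) (f : ↥Λ → F) :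
    0 ≤ cylProb μ Λ f := ENNReal.toReal_nonneg

lemma integral_restrict (μ : Measure (V d → F)) [IsProbabilityMeasure μ] (Λ : Finset (V d))
    (φ : (↥Λ → F) → ℝ) :
    ∫ ω, φ (Λ.restrict ω) ∂μ = ∑ f, cylProb μ Λ f * φ f := by
  have hm : Measurable (Λ.restrict : (V d → F) → (↥Λ → F)) := Finset.measurable_restrict Λ
  rw [← integral_map (φ := Λ.restrict) (f := φ) hm.aemeasurable
    (measurable_of_countable φ).aestronglyMeasurable, integral_fintype]
  · refine Finset.sum_congr rfl fun f _ => ?_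
    rw [cylProb_eq, smul_eq_mul, map_measureReal_apply hm (measurableSet_singleton f)]
  · have : IsProbabilityMeasure (μ.map (Λ.restrict : (V d → F) → (↥Λ → F))) :=
      Measure.isProbabilityMeasure_map hm.aemeasurable
    exact Integrable.of_finite

lemma sum_cylProb (μ : Measure (V d → F)) [IsProbabilityMeasure μ] (Λ : Finset (V d)) :
    ∑ f, cylProb μ Λ f = 1 := by
  have := integral_restrict μ Λ (fun _ => 1)
  simpa using this.symm

lemma sum_cylProb_rs (μ : Measure (V d → F)) [IsProbabilityMeasure μ] {Λ Λ' : Finset (V d)}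
    (h : Λ ⊆ Λ') (φ : (↥Λ → F) → ℝ) :
    ∑ f, cylProb μ Λ' f * φ (rs h f) = ∑ f, cylProb μ Λ f * φ f := by
  rw [← integral_restrict μ Λ, ← integral_restrict μ Λ' (fun f => φ (rs h f))]
  rfl

lemma cylProb_le_rs (μ : Measure (V d → F)) [IsProbabilityMeasure μ] {Λ Λ' : Finset (V d)}
    (h : Λ ⊆ Λ') (f : ↥Λ' → F) : cylProb μ Λ' f ≤ cylProb μ Λ (rs h f) := by
  refine ENNReal.toReal_mono (measure_ne_top _ _) (measure_mono ?_)
  intro ξ hξ x hx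
  exact hξ x (h hx)

lemma Hent_le (μ : Measure (V d → F)) [IsProbabilityMeasure μ] (Λ : Finset (V d))
    (q : (↥Λ → F) → ℝ) (hq : ∀ f, 0 < q f) :
    Hent μ Λ + ∑ f, cylProb μ Λ f * Real.log (q f) ≤ Real.log (∑ f, q f) := by
  have hne : Nonempty (↥Λ → F) := by
    by_contra h
    rw [not_nonempty_iff] at h
    have := sum_cylProb μ Λ
    simp at this
  have hZ : 0 < ∑ f, q f := Finset.sum_pos (fun f _ => hq f) Finset.univ_nonempty
  have := gibbs_ineq (cylProb μ Λ) (fun f => q f / ∑ f, q f) (cylProb_nonneg μ Λ)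
    (sum_cylProb μ Λ) (fun f => (div_pos (hq f) hZ).le)
    (by rw [← Finset.sum_div, div_self hZ.ne']) (fun f h => absurd h (div_pos (hq f) hZ).ne')
  have e : ∑ f, cylProb μ Λ f * Real.log (q f / ∑ f, q f) =
      ∑ f, cylProb μ Λ f * Real.log (q f) - Real.log (∑ f, q f) := by
    have : ∀ f, cylProb μ Λ f * Real.log (q f / ∑ f, q f) =
        cylProb μ Λ f * Real.log (q f) - cylProb μ Λ f * Real.log (∑ f, q f) := by
      intro f
      rw [Real.log_div (hq f).ne' hZ.ne', mul_sub]
    simp only [this]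
    rw [Finset.sum_sub_distrib, ← Finset.sum_mul, sum_cylProb, one_mul]
  rw [e] at this
  unfold Hent
  linarith

lemma Hent_nonneg (μ : Measure (V d → F)) [IsProbabilityMeasure μ] (Λ : Finset (V d)) :
    0 ≤ Hent μ Λ := by
  refine Finset.sum_nonneg fun f _ => Real.negMulLog_nonneg (cylProb_nonneg μ Λ f) ?_
  rw [← sum_cylProb μ Λ]
  exact Finset.single_le_sum (fun g _ => cylProb_nonneg μ Λ g) (Finset.mem_univ f)

lemma Hent_le_card (μ : Measure (V d → F)) [IsProbabilityMeasure μ] (Λ : Finset (V d)) :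
    Hent μ Λ ≤ Real.log (Fintype.card F) * (Λ.card : ℝ) := by
  have := Hent_le μ Λ (fun _ => 1) (fun _ => one_pos)
  classical
  simp only [Real.log_one, mul_zero, Finset.sum_const_zero, add_zero, Finset.sum_const,
    Finset.card_univ, nsmul_eq_mul, mul_one, Fintype.card_fun, Fintype.card_coe, Nat.cast_pow,
    Real.log_pow] at this
  linarith

lemma Hent_union (μ : Measure (V d → F)) [IsProbabilityMeasure μ] (Λ₁ Λ₂ : Finset (V d)) :
    Hent μ (Λ₁ ∪ Λ₂) ≤ Hent μ Λ₁ + Hent μ Λ₂ := by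
  have h1 : Λ₁ ⊆ Λ₁ ∪ Λ₂ := Finset.subset_union_left
  have h2 : Λ₂ ⊆ Λ₁ ∪ Λ₂ := Finset.subset_union_right
  have z1 : ∀ f, cylProb μ Λ₁ (rs h1 f) = 0 → cylProb μ (Λ₁ ∪ Λ₂) f = 0 := fun f h =>
    le_antisymm (h ▸ cylProb_le_rs μ h1 f) (cylProb_nonneg _ _ _)
  have z2 : ∀ f, cylProb μ Λ₂ (rs h2 f) = 0 → cylProb μ (Λ₁ ∪ Λ₂) f = 0 := fun f h =>
    le_antisymm (h ▸ cylProb_le_rs μ h2 f) (cylProb_nonneg _ _ _)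
  have := gibbs_ineq (cylProb μ (Λ₁ ∪ Λ₂))
    (fun f => cylProb μ Λ₁ (rs h1 f) * cylProb μ Λ₂ (rs h2 f)) (cylProb_nonneg μ _)
    (sum_cylProb μ _) (fun f => mul_nonneg (cylProb_nonneg _ _ _) (cylProb_nonneg _ _ _))
    ((sum_prod_le Λ₁ Λ₂ (cylProb μ Λ₁) (cylProb μ Λ₂) (cylProb_nonneg _ _)
      (cylProb_nonneg _ _)).trans (by rw [sum_cylProb, sum_cylProb, one_mul]))
    (fun f h => (mul_eq_zero.1 h).elim (z1 f) (z2 f))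
  have e : ∀ f, cylProb μ (Λ₁ ∪ Λ₂) f *
      Real.log (cylProb μ Λ₁ (rs h1 f) * cylProb μ Λ₂ (rs h2 f)) =
      cylProb μ (Λ₁ ∪ Λ₂) f * Real.log (cylProb μ Λ₁ (rs h1 f)) +
      cylProb μ (Λ₁ ∪ Λ₂) f * Real.log (cylProb μ Λ₂ (rs h2 f)) := by
    intro f
    by_cases a1 : cylProb μ Λ₁ (rs h1 f) = 0
    · rw [z1 f a1]; simp
    by_cases a2 : cylProb μ Λ₂ (rs h2 f) = 0
    · rw [z2 f a2]; simp
    rw [Real.log_mul a1 a2, mul_add]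
  simp only [e] at this
  rw [Finset.sum_add_distrib,
    sum_cylProb_rs μ h1 (fun g => Real.log (cylProb μ Λ₁ g)),
    sum_cylProb_rs μ h2 (fun g => Real.log (cylProb μ Λ₂ g))] at this
  have e1 : ∀ Λ : Finset (V d), Hent μ Λ = -∑ f, cylProb μ Λ f * Real.log (cylProb μ Λ f) := by
    intro Λ
    rw [Hent, ← Finset.sum_neg_distrib]
    exact Finset.sum_congr rfl fun f _ => by rw [Real.negMulLog, neg_mul]
  change Hent μ (Λ₁ ∪ Λ₂) ≤ _ at this
  rw [e1 Λ₁, e1 Λ₂]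
  linarith

lemma measurable_translate (a : V d) : Measurable (translate a : (V d → F) → V d → F) :=
  measurable_pi_lambda _ fun x => measurable_pi_apply (x + a)

lemma Hent_translate (μ : Measure (V d → F)) [IsProbabilityMeasure μ] (hμ : MeasTransInv μ)
    (a : V d) (Λ : Finset (V d)) :
    Hent μ (Λ.image (fun x => x + a)) ≤ Hent μ Λ := by
  set g : (↥(Λ.image (fun x => x + a)) → F) → (↥Λ → F) :=
    fun f x => f ⟨x + a, Finset.mem_image_of_mem _ x.2⟩ with hg
  have hinj : Function.Injective g := by
    intro f f' h
    funext ⟨x, hx⟩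
    obtain ⟨y, hy, rfl⟩ := Finset.mem_image.1 hx
    exact congrFun h ⟨y, hy⟩
  have e : ∀ f, cylProb μ (Λ.image (fun x => x + a)) f = cylProb μ Λ (g f) := by
    intro f
    rw [cylProb_eq μ Λ, ← hμ a, map_measureReal_apply (measurable_translate a)
      (Finset.measurable_restrict Λ (measurableSet_singleton _)), hμ a]
    unfold cylProb Measure.real
    congr 2
    ext ξ
    simp only [Set.mem_ofPred_eq, Set.mem_preimage, Set.mem_singleton_iff, funext_iff,
      Finset.restrict, Subtype.forall, hg, translate]
    constructor
    · intro h x hx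
      exact h _ _
    · intro h x hx
      obtain ⟨y, hy, rfl⟩ := Finset.mem_image.1 hx
      exact h y hy
  unfold Hent
  simp only [e]
  refine sum_inj_le g hinj (fun f => Real.negMulLog (cylProb μ Λ f)) fun f => ?_
  refine Real.negMulLog_nonneg (cylProb_nonneg μ Λ f) ?_
  rw [← sum_cylProb μ Λ]
  exact Finset.single_le_sum (fun g _ => cylProb_nonneg μ Λ g) (Finset.mem_univ f)

lemma entropy_spec (μ : Measure (V d → F)) [IsProbabilityMeasure μ] (hμ : MeasTransInv μ) :
    Tendsto (fun n => Hent μ (B d n) / ((B d n).card : ℝ)) atTop (𝓝 (entropy μ)) ∧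
      ∀ n, entropy μ ≤ Hent μ (B d n) / ((B d n).card : ℝ) := by
  have hC : 0 ≤ Real.log (Fintype.card F) := Real.log_natCast_nonneg _
  obtain ⟨ℓ, h1, h2⟩ := fekete (Hent μ) (Hent μ) _ hC (fun Λ₁ Λ₂ _ => Hent_union μ Λ₁ Λ₂)
    ((Hent_le_card μ ∅).trans (by simp)) (Hent_translate μ hμ) (Hent_le_card μ)
    (fun Λ => le_trans (neg_nonpos.2 (by positivity)) (Hent_nonneg μ Λ)) (fun _ => le_rfl)
    (by simp)
  have : entropy μ = ℓ := by
    unfold entropy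
    refine Tendsto.limUnder_eq (h1.congr fun n => ?_)
    have : Hent μ (B d n) = -∑ f, cylProb μ (B d n) f * Real.log (cylProb μ (B d n) f) := by
      rw [Hent, ← Finset.sum_neg_distrib]
      exact Finset.sum_congr rfl fun f _ => by rw [Real.negMulLog, neg_mul]
    rw [this]
    ring
  rw [this]
  exact ⟨h1, h2⟩

end Ent

set_option linter.unusedSectionVars false

/-! ### Interactions -/

section Inter
variable [Fintype F] [Nonempty F]

lemma fill_apply_mem {Λ : Finset (V d)} (f : ↥Λ → F) (η : V d → F) {x : V d} (h : x ∈ Λ) :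
    fill Λ f η x = f ⟨x, h⟩ := by
  simp [fill, h]

lemma bdd_inter {Φ : Interaction d F} (hl : IsLocal Φ) (Δ : Finset (V d)) :
    BddAbove (Set.range fun ω : V d → F => |Φ Δ ω|) := by
  refine Set.Finite.bddAbove (Set.Finite.subset
    (Set.finite_range fun f : ↥Δ → F => |Φ Δ (fill Δ f junkCfg)|) ?_)
  rintro _ ⟨ω, rfl⟩
  refine ⟨Δ.restrict ω, ?_⟩
  simp only
  rw [hl Δ _ ω fun x hx => fill_apply_mem _ _ hx]

lemma abs_le_supNorm {Φ : Interaction d F} (hl : IsLocal Φ) (Δ : Finset (V d)) (ω : V d → F) :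
    |Φ Δ ω| ≤ supNorm Φ Δ := le_ciSup (bdd_inter hl Δ) ω

lemma supNorm_nonneg (Φ : Interaction d F) (Δ : Finset (V d)) : 0 ≤ supNorm Φ Δ :=
  Real.iSup_nonneg fun _ => abs_nonneg _

/-- translation of finite sets -/
def sh (a : V d) : Finset (V d) ≃ Finset (V d) where
  toFun Δ := Δ.image (fun x => x - a)
  invFun Δ := Δ.image (fun x => x + a)
  left_inv Δ := by simp [Finset.image_image, Function.comp_def]
  right_inv Δ := by
    change Finset.image (fun x => x - a) (Finset.image (fun x => x + a) Δ) = Δ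
    rw [Finset.image_image]
    simp only [Function.comp_def, add_sub_cancel_right]
    exact Finset.image_id

lemma mem_sh {a x : V d} {Δ : Finset (V d)} : x ∈ sh a Δ ↔ x + a ∈ Δ := by
  simp only [sh, Equiv.coe_fn_mk, Finset.mem_image]
  constructor
  · rintro ⟨y, hy, rfl⟩
    simpa using hy
  · intro h
    exact ⟨_, h, by simp⟩

lemma translate_surj (a : V d) : Function.Surjective (translate a : (V d → F) → V d → F) := by
  intro ω
  exact ⟨fun x => ω (x - a), by funext x; simp [translate]⟩

lemma supNorm_sh {Φ : Interaction d F} (ht : TransInv Φ) (a : V d) (Δ : Finset (V d)) :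
    supNorm Φ (sh a Δ) = supNorm Φ Δ := by
  unfold supNorm
  rw [← (translate_surj (F := F) a).iSup_comp]
  exact iSup_congr fun ω => by rw [← ht a Δ ω]; rfl

open scoped Classical in
/-- weighted terms of sets containing `x` with property `q` -/
def wt (Φ : Interaction d F) (x : V d) (q : Finset (V d) → Prop) (Δ : Finset (V d)) : ℝ :=
  if x ∈ Δ ∧ q Δ then supNorm Φ Δ else 0

/-- total weight of sets containing `x` with property `q` -/
def W (Φ : Interaction d F) (x : V d) (q : Finset (V d) → Prop) : ℝ := ∑' Δ, wt Φ x q Δ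

lemma wt_nonneg (Φ : Interaction d F) (x : V d) (q : Finset (V d) → Prop) (Δ : Finset (V d)) :
    0 ≤ wt Φ x q Δ := by
  unfold wt
  split_ifs
  · exact supNorm_nonneg _ _
  · exact le_rfl

lemma wt_mono (Φ : Interaction d F) (x : V d) {q q' : Finset (V d) → Prop}
    (h : ∀ Δ, x ∈ Δ → q Δ → q' Δ) (Δ : Finset (V d)) : wt Φ x q Δ ≤ wt Φ x q' Δ := by
  unfold wt
  split_ifs with h1 h2
  · exact le_rfl
  · exact absurd ⟨h1.1, h Δ h1.1 h1.2⟩ h2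
  · exact supNorm_nonneg _ _
  · exact le_rfl

lemma wt_true {Φ : Interaction d F} (ht : TransInv Φ) (x : V d) :
    wt Φ x (fun _ => True) = normTerm Φ ∘ sh x := by
  funext Δ
  have : (0 : V d) ∈ sh x Δ ↔ x ∈ Δ := by rw [mem_sh, zero_add]
  simp only [wt, normTerm, Function.comp, this, supNorm_sh ht, and_true]

lemma wt_true_summable {Φ : Interaction d F} (ht : TransInv Φ) (hs : AbsSummable Φ) (x : V d) :
    Summable (wt Φ x (fun _ => True)) := by
  rw [wt_true ht]
  exact (sh x).summable_iff.2 hs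

lemma wt_summable {Φ : Interaction d F} (ht : TransInv Φ) (hs : AbsSummable Φ) (x : V d)
    (q : Finset (V d) → Prop) : Summable (wt Φ x q) :=
  Summable.of_nonneg_of_le (wt_nonneg Φ x q) (wt_mono Φ x fun _ _ _ => trivial)
    (wt_true_summable ht hs x)

lemma W_nonneg (Φ : Interaction d F) (x : V d) (q : Finset (V d) → Prop) : 0 ≤ W Φ x q :=
  tsum_nonneg (wt_nonneg Φ x q)

lemma W_mono {Φ : Interaction d F} (ht : TransInv Φ) (hs : AbsSummable Φ) (x : V d)
    {q q' : Finset (V d) → Prop} (h : ∀ Δ, x ∈ Δ → q Δ → q' Δ) : W Φ x q ≤ W Φ x q' :=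
  (wt_summable ht hs x q).tsum_le_tsum (wt_mono Φ x h) (wt_summable ht hs x q')

lemma W_true {Φ : Interaction d F} (ht : TransInv Φ) (x : V d) :
    W Φ x (fun _ => True) = anorm Φ := by
  unfold W anorm
  rw [wt_true ht]
  exact (sh x).tsum_eq (normTerm Φ)

lemma W_le {Φ : Interaction d F} (ht : TransInv Φ) (hs : AbsSummable Φ) (x : V d)
    (q : Finset (V d) → Prop) : W Φ x q ≤ anorm Φ := by
  rw [← W_true ht x]
  exact W_mono ht hs x fun _ _ _ => trivial

lemma anorm_nonneg {Φ : Interaction d F} : 0 ≤ anorm Φ :=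
  tsum_nonneg fun Δ => by
    unfold normTerm
    split_ifs
    · exact supNorm_nonneg _ _
    · exact le_rfl

lemma W_shift {Φ : Interaction d F} (ht : TransInv Φ) (a x : V d) (q : Finset (V d) → Prop) :
    W Φ x (fun Δ => q Δ) = W Φ (x + a) (fun Δ => q (sh a Δ)) := by
  unfold W
  rw [← (sh a).tsum_eq]
  refine tsum_congr fun Δ => ?_
  simp only [wt, supNorm_sh ht]
  have h : x ∈ sh a Δ ↔ x + a ∈ Δ := mem_sh
  split_ifs with h1 h2 h2
  · rfl
  · exact absurd ⟨h.1 h1.1, h1.2⟩ h2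
  · exact absurd ⟨h.2 h2.1, h2.2⟩ h1
  · rfl

/-- boundary energy -/
def bd (Φ : Interaction d F) (Λ : Finset (V d)) : ℝ := ∑ x ∈ Λ, W Φ x (fun Δ => ¬ Δ ⊆ Λ)

lemma bd_nonneg (Φ : Interaction d F) (Λ : Finset (V d)) : 0 ≤ bd Φ Λ :=
  Finset.sum_nonneg fun x _ => W_nonneg Φ x _

lemma bd_le {Φ : Interaction d F} (ht : TransInv Φ) (hs : AbsSummable Φ) (Λ : Finset (V d)) :
    bd Φ Λ ≤ anorm Φ * (Λ.card : ℝ) := by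
  refine (Finset.sum_le_card_nsmul _ _ _ fun x _ => W_le ht hs x _).trans ?_
  rw [nsmul_eq_mul, mul_comm]

lemma image_add_subset {a : V d} {Δ Λ : Finset (V d)} :
    Δ ⊆ Λ.image (fun x => x + a) ↔ sh a Δ ⊆ Λ := by
  constructor
  · intro h x hx
    obtain ⟨y, hy, e⟩ := Finset.mem_image.1 (h (mem_sh.1 hx))
    rwa [← add_right_cancel e]
  · intro h x hx
    refine Finset.mem_image.2 ⟨x - a, h (mem_sh.2 (by simpa using hx)), by simp⟩

lemma bd_translate {Φ : Interaction d F} (ht : TransInv Φ) (a : V d) (Λ : Finset (V d)) :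
    bd Φ (Λ.image (fun x => x + a)) = bd Φ Λ := by
  unfold bd
  rw [Finset.sum_image (fun x _ y _ h => add_right_cancel h)]
  refine Finset.sum_congr rfl fun x _ => ?_
  rw [W_shift ht a x (fun Δ => ¬ Δ ⊆ Λ)]
  simp only [image_add_subset]

lemma sum_le_W {Φ : Interaction d F} (ht : TransInv Φ) (hs : AbsSummable Φ)
    (P : Finset (Finset (V d))) (Λ : Finset (V d)) (q : Finset (V d) → Prop)
    (hP : ∀ Δ ∈ P, q Δ ∧ ∃ x ∈ Λ, x ∈ Δ) :
    ∑ Δ ∈ P, supNorm Φ Δ ≤ ∑ x ∈ Λ, W Φ x q := by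
  calc ∑ Δ ∈ P, supNorm Φ Δ ≤ ∑ Δ ∈ P, ∑ x ∈ Λ, wt Φ x q Δ := by
        refine Finset.sum_le_sum fun Δ hΔ => ?_
        obtain ⟨hq, x, hx, hxΔ⟩ := hP Δ hΔ
        have : supNorm Φ Δ = wt Φ x q Δ := by simp [wt, hq, hxΔ]
        rw [this]
        exact Finset.single_le_sum (f := fun x => wt Φ x q Δ) (fun y _ => wt_nonneg Φ y q Δ) hx
    _ = ∑ x ∈ Λ, ∑ Δ ∈ P, wt Φ x q Δ := Finset.sum_comm
    _ ≤ _ := Finset.sum_le_sum fun x _ =>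
        (wt_summable ht hs x q).sum_le_tsum P fun Δ _ => wt_nonneg Φ x q Δ

lemma bd_tendsto {Φ : Interaction d F} (ht : TransInv Φ) (hs : AbsSummable Φ) :
    Tendsto (fun n => bd Φ (B d n) / ((B d n).card : ℝ)) atTop (𝓝 0) := by
  rw [Metric.tendsto_atTop']
  intro ε hε
  -- a finite set of sets carrying most of the norm
  have hs' := wt_summable ht hs 0 (fun _ => True)
  obtain ⟨s, hsε⟩ := ((tendsto_order.1 (tendsto_tsum_compl_atTop_zero
    (wt Φ 0 (fun _ => True)))).2 (ε / 2) (half_pos hε)).exists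
  obtain ⟨r, hr⟩ := exists_B_subset d (s.biUnion id)
  have hWs : W Φ 0 (fun Δ => Δ ∉ s) ≤ ε / 2 := by
    refine le_of_eq_of_le ?_ hsε.le
    unfold W
    rw [← tsum_subtype_eq_of_support_subset (s := {Δ | Δ ∉ s})]
    · refine tsum_congr fun Δ => ?_
      have : (Δ : Finset (V d)) ∉ s := Δ.2
      simp [wt, this]
    · intro Δ h
      simp only [Function.mem_support, wt] at h
      by_contra h'
      exact h (if_neg fun h'' => h' h''.2)
  have hx1 : ∀ n, r ≤ n → ∀ x ∈ B d (n - r), W Φ x (fun Δ => ¬ Δ ⊆ B d n) ≤ ε / 2 := by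
    intro n hn x hx
    refine le_trans ?_ hWs
    rw [W_shift ht x 0 (fun Δ => Δ ∉ s), zero_add]
    refine W_mono ht hs x fun Δ hxΔ hΔ hmem => hΔ fun y hy => ?_
    have h1 : y - x ∈ B d r :=
      hr (Finset.mem_biUnion.2 ⟨_, hmem, mem_sh.2 (by simpa using hy)⟩)
    rw [mem_B] at *
    intro i
    have := h1 i
    have := hx i
    simp only [Pi.sub_apply] at *
    omega
  have hbd : ∀ n, r ≤ n →
      bd Φ (B d n) / ((B d n).card : ℝ) ≤ ε / 2 + anorm Φ * rho d r n := by
    intro n hn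
    have hc := card_B_pos d n
    have hsub := B_mono d (Nat.sub_le n r)
    rw [div_le_iff₀ hc]
    unfold bd
    rw [← Finset.sum_sdiff hsub]
    have k1 : ∑ x ∈ B d (n - r), W Φ x (fun Δ => ¬ Δ ⊆ B d n) ≤
        ((B d (n-r)).card : ℝ) * (ε / 2) := by
      refine (Finset.sum_le_card_nsmul _ _ _ (hx1 n hn)).trans ?_
      rw [nsmul_eq_mul]
    have k2 : ∑ x ∈ B d n \ B d (n - r), W Φ x (fun Δ => ¬ Δ ⊆ B d n) ≤
        ((B d n \ B d (n-r)).card : ℝ) * anorm Φ := by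
      refine (Finset.sum_le_card_nsmul _ _ _ (fun x _ => W_le ht hs x _)).trans ?_
      rw [nsmul_eq_mul]
    have k3 : ((B d (n-r)).card : ℝ) ≤ ((B d n).card : ℝ) := by
      exact_mod_cast Finset.card_le_card hsub
    have k4 : (ε / 2 + anorm Φ * rho d r n) * ((B d n).card : ℝ) =
        ((B d n).card : ℝ) * (ε / 2) + ((B d n \ B d (n-r)).card : ℝ) * anorm Φ := by
      unfold rho
      field_simp
    rw [k4]
    have := mul_le_mul_of_nonneg_right k3 (half_pos hε).le
    linarith
  have hr0 : Tendsto (fun m => anorm Φ * rho d r m) atTop (𝓝 0) := by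
    simpa using (tendsto_rho d r).const_mul (anorm Φ)
  obtain ⟨N, hN⟩ := eventually_atTop.1
    ((hr0.eventually (gt_mem_nhds (half_pos hε))).and (eventually_ge_atTop r))
  refine ⟨N, fun n hn => ?_⟩
  obtain ⟨k1, k2⟩ := hN n hn.le
  have := hbd n k2
  have h0 : 0 ≤ bd Φ (B d n) / ((B d n).card : ℝ) := div_nonneg (bd_nonneg _ _) (card_B_pos d n).le
  rw [Real.dist_eq, sub_zero, abs_of_nonneg h0]
  linarith

/-- Energy (without the empty set). -/
def En (Φ : Interaction d F) (Λ : Finset (V d)) (ω : V d → F) : ℝ :=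
  ∑ Δ ∈ Λ.powerset.erase ∅, Φ Δ ω

lemma En_local {Φ : Interaction d F} (hl : IsLocal Φ) {Λ : Finset (V d)} {ω ω' : V d → F}
    (h : ∀ x ∈ Λ, ω x = ω' x) : En Φ Λ ω = En Φ Λ ω' := by
  refine Finset.sum_congr rfl fun Δ hΔ => hl Δ _ _ fun x hx => h x ?_
  exact Finset.mem_powerset.1 (Finset.mem_of_mem_erase hΔ) hx

lemma En_abs_le {Φ : Interaction d F} (hl : IsLocal Φ) (ht : TransInv Φ) (hs : AbsSummable Φ)
    (Λ : Finset (V d)) (ω : V d → F) : |En Φ Λ ω| ≤ anorm Φ * (Λ.card : ℝ) := by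
  calc |En Φ Λ ω| ≤ ∑ Δ ∈ Λ.powerset.erase ∅, supNorm Φ Δ :=
        (Finset.abs_sum_le_sum_abs _ _).trans
          (Finset.sum_le_sum fun Δ _ => abs_le_supNorm hl Δ ω)
    _ ≤ ∑ x ∈ Λ, W Φ x (fun _ => True) := by
        refine sum_le_W ht hs _ Λ _ fun Δ hΔ => ⟨trivial, ?_⟩
        rw [Finset.mem_erase, Finset.mem_powerset] at hΔ
        obtain ⟨x, hx⟩ := Finset.nonempty_iff_ne_empty.2 hΔ.1
        exact ⟨x, hΔ.2 hx, hx⟩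
    _ = _ := by simp [W_true ht, mul_comm]

lemma En_union {Φ : Interaction d F} (hl : IsLocal Φ) (ht : TransInv Φ) (hs : AbsSummable Φ)
    {Λ₁ Λ₂ : Finset (V d)} (hd : Disjoint Λ₁ Λ₂) (ω : V d → F) :
    En Φ Λ₁ ω + En Φ Λ₂ ω - bd Φ Λ₂ ≤ En Φ (Λ₁ ∪ Λ₂) ω := by
  set P1 := Λ₁.powerset.erase ∅
  set P2 := Λ₂.powerset.erase ∅
  set P := (Λ₁ ∪ Λ₂).powerset.erase ∅
  have hdP : Disjoint P1 P2 := by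
    rw [Finset.disjoint_left]
    intro Δ h1 h2
    simp only [P1, P2, Finset.mem_erase, Finset.mem_powerset] at h1 h2
    exact h1.1 (Finset.subset_empty.1 (hd h1.2 h2.2))
  have hsub : P1 ∪ P2 ⊆ P := by
    intro Δ h
    simp only [P1, P2, P, Finset.mem_union, Finset.mem_erase, Finset.mem_powerset] at h ⊢
    rcases h with h | h
    · exact ⟨h.1, h.2.trans Finset.subset_union_left⟩
    · exact ⟨h.1, h.2.trans Finset.subset_union_right⟩
  have e : En Φ (Λ₁ ∪ Λ₂) ω = ∑ Δ ∈ P \ (P1 ∪ P2), Φ Δ ω + (En Φ Λ₁ ω + En Φ Λ₂ ω) := by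
    unfold En
    rw [← Finset.sum_union hdP, Finset.sum_sdiff hsub]
  have b : ∑ Δ ∈ P \ (P1 ∪ P2), supNorm Φ Δ ≤ bd Φ Λ₂ := by
    refine sum_le_W ht hs _ Λ₂ _ fun Δ hΔ => ?_
    simp only [P1, P2, P, Finset.mem_sdiff, Finset.mem_union, Finset.mem_erase,
      Finset.mem_powerset, not_or, not_and] at hΔ
    obtain ⟨⟨h0, h1⟩, h2, h3⟩ := hΔ
    refine ⟨h3 h0, ?_⟩
    by_contra hne
    push Not at hne
    refine h2 h0 fun x hx => ?_
    rcases Finset.mem_union.1 (h1 hx) with h | h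
    · exact h
    · exact absurd hx (hne x h)
  have c : |∑ Δ ∈ P \ (P1 ∪ P2), Φ Δ ω| ≤ bd Φ Λ₂ :=
    ((Finset.abs_sum_le_sum_abs _ _).trans
      (Finset.sum_le_sum fun Δ _ => abs_le_supNorm hl Δ ω)).trans b
  rw [e]
  linarith [(abs_le.1 c).1]

lemma En_translate {Φ : Interaction d F} (ht : TransInv Φ) (a : V d) (Λ : Finset (V d))
    (ω : V d → F) : En Φ (Λ.image (fun x => x + a)) ω = En Φ Λ (translate a ω) := by
  unfold En
  refine Finset.sum_equiv (sh a) (fun Δ => ?_) (fun Δ _ => (ht a Δ ω).symm)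
  simp only [Finset.mem_erase, Finset.mem_powerset, image_add_subset]
  have : sh a Δ = ∅ ↔ Δ = ∅ := by simp [sh]
  rw [ne_eq, ne_eq, this]

/-- partition function without the empty set -/
def Zp (Φ : Interaction d F) (Λ : Finset (V d)) : ℝ :=
  ∑ f : ↥Λ → F, Real.exp (-(En Φ Λ (fill Λ f junkCfg)))

lemma Zp_pos (Φ : Interaction d F) (Λ : Finset (V d)) : 0 < Zp Φ Λ :=
  Finset.sum_pos (fun _ _ => Real.exp_pos _) Finset.univ_nonempty

lemma freeZ_eq {Φ : Interaction d F} (hl : IsLocal Φ) (Λ : Finset (V d)) :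
    freeZ Φ Λ = Real.exp (-(Φ ∅ junkCfg)) * Zp Φ Λ := by
  unfold freeZ Zp
  rw [Finset.mul_sum]
  refine Finset.sum_congr rfl fun f _ => ?_
  rw [← Real.exp_add, En, ← Finset.add_sum_erase _ _ (Finset.empty_mem_powerset Λ),
    hl ∅ (fill Λ f junkCfg) junkCfg (by simp)]
  congr 1
  ring

lemma Zp_translate {Φ : Interaction d F} (hl : IsLocal Φ) (ht : TransInv Φ) (a : V d)
    (Λ : Finset (V d)) : Zp Φ (Λ.image (fun x => x + a)) ≤ Zp Φ Λ := by
  set g : (↥(Λ.image (fun x => x + a)) → F) → (↥Λ → F) :=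
    fun f x => f ⟨x + a, Finset.mem_image_of_mem _ x.2⟩ with hg
  have hinj : Function.Injective g := by
    intro f f' h
    funext ⟨x, hx⟩
    obtain ⟨y, hy, rfl⟩ := Finset.mem_image.1 hx
    exact congrFun h ⟨y, hy⟩
  unfold Zp
  refine le_of_eq_of_le (Finset.sum_congr rfl fun f _ => ?_)
    (sum_inj_le g hinj (fun f => Real.exp (-(En Φ Λ (fill Λ f junkCfg))))
      fun f => (Real.exp_pos _).le)
  rw [En_translate ht]
  congr 2
  refine En_local hl fun x hx => ?_
  rw [fill_apply_mem _ _ hx, translate, fill_apply_mem _ _ (Finset.mem_image_of_mem _ hx)]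

lemma logZp_abs_le {Φ : Interaction d F} (hl : IsLocal Φ) (ht : TransInv Φ) (hs : AbsSummable Φ)
    (Λ : Finset (V d)) :
    Real.log (Zp Φ Λ) ≤ (Real.log (Fintype.card F) + anorm Φ) * (Λ.card : ℝ) ∧
    -(anorm Φ * (Λ.card : ℝ)) ≤ Real.log (Zp Φ Λ) := by
  classical
  constructor
  · have h1 : Zp Φ Λ ≤ (Fintype.card F : ℝ) ^ Λ.card * Real.exp (anorm Φ * (Λ.card : ℝ)) := by
      unfold Zp
      refine (Finset.sum_le_card_nsmul _ _ (Real.exp (anorm Φ * (Λ.card : ℝ))) fun f _ => ?_).trans ?_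
      · rw [Real.exp_le_exp]
        exact (neg_le_abs _).trans (En_abs_le hl ht hs Λ _)
      · simp [Finset.card_univ, nsmul_eq_mul]
    have h2 := Real.log_le_log (Zp_pos Φ Λ) h1
    have hF : (0 : ℝ) < Fintype.card F := by exact_mod_cast Fintype.card_pos
    rw [Real.log_mul (pow_pos hF _).ne' (Real.exp_pos _).ne', Real.log_pow, Real.log_exp] at h2
    linarith
  · rw [Real.le_log_iff_exp_le (Zp_pos Φ Λ)]
    refine le_trans ?_ (Finset.single_le_sum (f := fun f : ↥Λ → F =>
      Real.exp (-(En Φ Λ (fill Λ f junkCfg)))) (fun _ _ => (Real.exp_pos _).le)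
      (Finset.mem_univ (fun _ => Classical.arbitrary F)))
    rw [Real.exp_le_exp]
    have := En_abs_le hl ht hs Λ (fill Λ (fun _ => Classical.arbitrary F) junkCfg)
    linarith [(abs_le.1 this).2]

lemma logZp_union {Φ : Interaction d F} (hl : IsLocal Φ) (ht : TransInv Φ) (hs : AbsSummable Φ)
    {Λ₁ Λ₂ : Finset (V d)} (hd : Disjoint Λ₁ Λ₂) :
    Real.log (Zp Φ (Λ₁ ∪ Λ₂)) ≤ Real.log (Zp Φ Λ₁) + (Real.log (Zp Φ Λ₂) + bd Φ Λ₂) := by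
  have key : Zp Φ (Λ₁ ∪ Λ₂) ≤ Real.exp (bd Φ Λ₂) * (Zp Φ Λ₁ * Zp Φ Λ₂) := by
    refine le_trans ?_ (mul_le_mul_of_nonneg_left (sum_prod_le Λ₁ Λ₂
      (fun f => Real.exp (-(En Φ Λ₁ (fill Λ₁ f junkCfg))))
      (fun f => Real.exp (-(En Φ Λ₂ (fill Λ₂ f junkCfg))))
      (fun f => (Real.exp_pos _).le) (fun f => (Real.exp_pos _).le)) (Real.exp_pos _).le)
    rw [Finset.mul_sum]
    refine Finset.sum_le_sum fun f _ => ?_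
    rw [← Real.exp_add, ← Real.exp_add, Real.exp_le_exp]
    have h := En_union hl ht hs hd (fill (Λ₁ ∪ Λ₂) f junkCfg)
    have e1 : En Φ Λ₁ (fill (Λ₁ ∪ Λ₂) f junkCfg) =
        En Φ Λ₁ (fill Λ₁ (rs Finset.subset_union_left f) junkCfg) := En_local hl fun x hx => by
      rw [fill_apply_mem _ _ hx, fill_apply_mem _ _ (Finset.mem_union_left _ hx), rs]
    have e2 : En Φ Λ₂ (fill (Λ₁ ∪ Λ₂) f junkCfg) =
        En Φ Λ₂ (fill Λ₂ (rs Finset.subset_union_right f) junkCfg) := En_local hl fun x hx => by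
      rw [fill_apply_mem _ _ hx, fill_apply_mem _ _ (Finset.mem_union_right _ hx), rs]
    rw [e1, e2] at h
    linarith
  have h2 := Real.log_le_log (Zp_pos Φ _) key
  have p1 := Zp_pos Φ Λ₁
  have p2 := Zp_pos Φ Λ₂
  rw [Real.log_mul (Real.exp_pos _).ne' (mul_pos p1 p2).ne', Real.log_exp,
    Real.log_mul p1.ne' p2.ne'] at h2
  linarith

lemma tendsto_card_B (hd : 1 ≤ d) : Tendsto (fun n => ((B d n).card : ℝ)) atTop atTop := by
  refine tendsto_atTop_mono (f := fun n : ℕ => (n : ℝ)) (fun n => ?_) tendsto_natCast_atTop_atTop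
  rw [card_B]
  have : n ≤ (2 * n + 1) ^ d := by
    calc n ≤ (2 * n + 1) ^ 1 := by rw [pow_one]; omega
      _ ≤ _ := Nat.pow_le_pow_right (by omega) hd
  exact_mod_cast this

lemma pressure_spec (hd : 1 ≤ d) {Φ : Interaction d F} (hl : IsLocal Φ) (ht : TransInv Φ)
    (hs : AbsSummable Φ) :
    Tendsto (fun n => Real.log (Zp Φ (B d n)) / ((B d n).card : ℝ)) atTop (𝓝 (pressure Φ)) := by
  have hC : 0 ≤ Real.log (Fintype.card F) := Real.log_natCast_nonneg _
  have hA : 0 ≤ anorm Φ := anorm_nonneg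
  obtain ⟨ℓ, h1, -⟩ := fekete (fun Λ => Real.log (Zp Φ Λ)) (fun Λ => Real.log (Zp Φ Λ) + bd Φ Λ)
    (Real.log (Fintype.card F) + 2 * anorm Φ) (by positivity)
    (fun Λ₁ Λ₂ h => logZp_union hl ht hs h)
    ((logZp_abs_le hl ht hs ∅).1.trans (by simp))
    (fun a Λ => add_le_add (Real.log_le_log (Zp_pos _ _) (Zp_translate hl ht a Λ))
      (bd_translate ht a Λ).le)
    (fun Λ => by
      have := (logZp_abs_le hl ht hs Λ).1
      have := bd_le ht hs Λ
      linarith)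
    (fun Λ => by
      have := (logZp_abs_le hl ht hs Λ).2
      have : 0 ≤ Real.log (Fintype.card F) * (Λ.card : ℝ) := by positivity
      have : 0 ≤ anorm Φ * (Λ.card : ℝ) := by positivity
      linarith)
    (fun Λ => by linarith [bd_nonneg Φ Λ])
    (by simpa using bd_tendsto ht hs)
  have h2 : Tendsto (fun n => (-(Φ ∅ junkCfg)) / ((B d n).card : ℝ)) atTop (𝓝 0) :=
    Tendsto.div_atTop tendsto_const_nhds (tendsto_card_B hd)
  have : pressure Φ = ℓ := by
    unfold pressure
    refine Tendsto.limUnder_eq ?_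
    have := h2.add h1
    rw [zero_add] at this
    refine this.congr fun n => ?_
    rw [freeZ_eq hl, Real.log_mul (Real.exp_pos _).ne' (Zp_pos _ _).ne', Real.log_exp]
    ring
  rwa [this]

end Inter

/-! ### The middle element -/

open scoped Classical in
/-- lexicographic rank -/
def rk (Δ : Finset (V d)) (x : V d) : ℕ := (Δ.filter fun y => lexLt y x).card

lemma isMid_sh {Δ : Finset (V d)} {x : V d} :
    IsMid (sh x Δ) ↔ x ∈ Δ ∧ rk Δ x + 1 = (Δ.card + 1) / 2 := by
  classical
  have hinj : Function.Injective (fun y : V d => y - x) := sub_left_injective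
  have h1 : (sh x Δ).card = Δ.card := Finset.card_image_of_injective _ hinj
  have h2 : ((sh x Δ).filter fun y => lexLt y 0) =
      (Δ.filter fun y => lexLt y x).image (fun y => y - x) := by
    change ((Δ.image (fun y => y - x)).filter fun y => lexLt y 0) = _
    rw [Finset.filter_image]
    congr 1
    refine Finset.filter_congr fun y _ => ?_
    exact sub_neg (a := toLex y) (b := toLex x)
  have h3 : (0 : V d) ∈ sh x Δ ↔ x ∈ Δ := by rw [mem_sh, zero_add]
  have h4 : ((sh x Δ).filter fun y => lexLt y 0).card = rk Δ x := by
    rw [h2, Finset.card_image_of_injective _ hinj]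
    unfold rk
    congr!
  unfold IsMid
  rw [h1, h3, ← h4]

lemma rk_lt {Δ : Finset (V d)} {x y : V d} (hx : x ∈ Δ) (h : toLex x < toLex y) :
    rk Δ x < rk Δ y := by
  classical
  unfold rk
  refine Finset.card_lt_card ⟨fun z hz => ?_, fun hh => ?_⟩
  · rw [Finset.mem_filter] at hz ⊢
    exact ⟨hz.1, lt_trans (show toLex z < toLex x from hz.2) h⟩
  · have := (Finset.mem_filter.1 (hh (Finset.mem_filter.2 ⟨hx, h⟩))).2
    exact lt_irrefl (toLex x) this

lemma rk_injOn (Δ : Finset (V d)) : Set.InjOn (rk Δ) (Δ : Set (V d)) := by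
  intro x hx y hy h
  rcases lt_trichotomy (toLex x) (toLex y) with h1 | h1 | h1
  · exact absurd h (rk_lt hx h1).ne
  · exact toLex.injective h1
  · exact absurd h (rk_lt hy h1).ne'

lemma exists_mid {Δ : Finset (V d)} (hΔ : Δ ≠ ∅) :
    ∃ x ∈ Δ, ∀ y, IsMid (sh y Δ) ↔ y = x := by
  classical
  have hpos : 0 < Δ.card := Finset.card_pos.2 (Finset.nonempty_iff_ne_empty.2 hΔ)
  have hs : Set.SurjOn (rk Δ) (Δ : Set (V d)) (Finset.range Δ.card : Set ℕ) := by
    refine Finset.surjOn_of_injOn_of_card_le _ (fun x hx => ?_) (rk_injOn Δ) (by simp)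
    rw [Finset.mem_coe, Finset.mem_range]
    unfold rk
    refine Finset.card_lt_card ⟨Finset.filter_subset _ _, fun hh => ?_⟩
    exact lt_irrefl (toLex x) (Finset.mem_filter.1 (hh hx)).2
  obtain ⟨x, hx, hxr⟩ := hs (show (Δ.card + 1) / 2 - 1 ∈ (Finset.range Δ.card : Set ℕ) by
    rw [Finset.mem_coe, Finset.mem_range]; omega)
  refine ⟨x, hx, fun y => ?_⟩
  rw [isMid_sh]
  constructor
  · rintro ⟨hy, h⟩
    exact rk_injOn Δ hy hx (by omega)
  · rintro rfl
    exact ⟨hx, by omega⟩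

section Var
variable [Fintype F] [Nonempty F] [MeasurableSpace F]
    [TopologicalSpace F] [DiscreteTopology F] [BorelSpace F]

lemma inter_continuous {Φ : Interaction d F} (hl : IsLocal Φ) (Δ : Finset (V d)) :
    Continuous (Φ Δ) := by
  have : Φ Δ = (fun f : ↥Δ → F => Φ Δ (fill Δ f junkCfg)) ∘ Δ.restrict := by
    funext ω
    exact hl Δ _ _ fun x hx => by rw [fill_apply_mem _ _ hx]; rfl
  rw [this]
  exact continuous_of_discreteTopology.comp (Finset.continuous_restrict Δ)

lemma inter_integrable {Φ : Interaction d F} (hl : IsLocal Φ) (Δ : Finset (V d))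
    (μ : Measure (V d → F)) [IsProbabilityMeasure μ] : Integrable (Φ Δ) μ := by
  refine Integrable.of_bound (inter_continuous hl Δ).aestronglyMeasurable (supNorm Φ Δ) ?_
  exact Eventually.of_forall fun ω => abs_le_supNorm hl Δ ω

open scoped Classical in
/-- summand of `AFn` -/
def aterm (Φ : Interaction d F) (Δ : Finset (V d)) (ω : V d → F) : ℝ :=
  if IsMid Δ then Φ Δ ω else 0

lemma AFn_eq (Φ : Interaction d F) (ω : V d → F) : AFn Φ ω = -∑' Δ, aterm Φ Δ ω := rfl

lemma aterm_abs_le {Φ : Interaction d F} (hl : IsLocal Φ) (Δ : Finset (V d)) (ω : V d → F) :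
    ‖aterm Φ Δ ω‖ ≤ normTerm Φ Δ := by
  unfold aterm normTerm
  by_cases h : IsMid Δ
  · rw [if_pos h, if_pos h.1]
    exact abs_le_supNorm hl Δ ω
  · rw [if_neg h, norm_zero]
    split_ifs
    · exact supNorm_nonneg _ _
    · exact le_rfl

lemma aterm_continuous {Φ : Interaction d F} (hl : IsLocal Φ) (Δ : Finset (V d)) :
    Continuous (aterm Φ Δ) := by
  unfold aterm
  split_ifs
  · exact inter_continuous hl Δ
  · exact continuous_const

lemma AFn_continuous {Φ : Interaction d F} (hl : IsLocal Φ) (hs : AbsSummable Φ) :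
    Continuous (AFn Φ) :=
  (continuous_tsum (aterm_continuous hl) hs (aterm_abs_le hl)).neg

lemma AFn_abs_le {Φ : Interaction d F} (hl : IsLocal Φ) (hs : AbsSummable Φ) (ω : V d → F) :
    ‖AFn Φ ω‖ ≤ anorm Φ := by
  rw [AFn_eq, norm_neg]
  exact tsum_of_norm_bounded hs.hasSum fun Δ => aterm_abs_le hl Δ ω

lemma AFn_integrable {Φ : Interaction d F} (hl : IsLocal Φ) (hs : AbsSummable Φ)
    (μ : Measure (V d → F)) [IsProbabilityMeasure μ] : Integrable (AFn Φ) μ :=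
  Integrable.of_bound (AFn_continuous hl hs).aestronglyMeasurable (anorm Φ)
    (Eventually.of_forall fun ω => AFn_abs_le hl hs ω)

/-- mean of a local term -/
def mn (Φ : Interaction d F) (μ : Measure (V d → F)) (Δ : Finset (V d)) : ℝ := ∫ ω, Φ Δ ω ∂μ

lemma mn_abs_le {Φ : Interaction d F} (hl : IsLocal Φ) (μ : Measure (V d → F))
    [IsProbabilityMeasure μ] (Δ : Finset (V d)) : |mn Φ μ Δ| ≤ supNorm Φ Δ := by
  have := norm_integral_le_of_norm_le_const (μ := μ) (f := Φ Δ) (C := supNorm Φ Δ)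
    (Eventually.of_forall fun ω => abs_le_supNorm hl Δ ω)
  simpa [mn] using this

lemma mn_sh {Φ : Interaction d F} (hl : IsLocal Φ) (ht : TransInv Φ) (μ : Measure (V d → F))
    [IsProbabilityMeasure μ] (hμ : MeasTransInv μ) (a : V d) (Δ : Finset (V d)) :
    mn Φ μ (sh a Δ) = mn Φ μ Δ := by
  unfold mn
  conv_lhs => rw [← hμ a]
  rw [integral_map (measurable_translate a).aemeasurable
    (inter_continuous hl _).aestronglyMeasurable]
  exact integral_congr_ae (Eventually.of_forall fun ω => ht a Δ ω)

open scoped Classical in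
/-- mean term with middle point `x` -/
def mterm (Φ : Interaction d F) (μ : Measure (V d → F)) (x : V d) (Δ : Finset (V d)) : ℝ :=
  if IsMid (sh x Δ) then mn Φ μ Δ else 0

lemma mterm_abs_le {Φ : Interaction d F} (hl : IsLocal Φ) (μ : Measure (V d → F))
    [IsProbabilityMeasure μ] (x : V d) (Δ : Finset (V d)) :
    ‖mterm Φ μ x Δ‖ ≤ wt Φ x (fun _ => True) Δ := by
  unfold mterm
  by_cases h : IsMid (sh x Δ)
  · rw [if_pos h, wt, if_pos ⟨(isMid_sh.1 h).1, trivial⟩]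
    exact mn_abs_le hl μ Δ
  · rw [if_neg h, norm_zero]
    exact wt_nonneg _ _ _ _

lemma integral_AFn {Φ : Interaction d F} (hl : IsLocal Φ) (ht : TransInv Φ) (hs : AbsSummable Φ)
    (μ : Measure (V d → F)) [IsProbabilityMeasure μ] (hμ : MeasTransInv μ) (x : V d) :
    ∫ ω, AFn Φ ω ∂μ = -∑' Δ, mterm Φ μ x Δ := by
  have hintg : ∀ Δ, Integrable (aterm Φ Δ) μ := fun Δ =>
    Integrable.of_bound (aterm_continuous hl Δ).aestronglyMeasurable (normTerm Φ Δ)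
      (Eventually.of_forall fun ω => aterm_abs_le hl Δ ω)
  have hsum : Summable fun Δ => ∫ ω, ‖aterm Φ Δ ω‖ ∂μ := by
    refine Summable.of_nonneg_of_le (fun Δ => integral_nonneg fun _ => norm_nonneg _)
      (fun Δ => ?_) hs
    calc ∫ ω, ‖aterm Φ Δ ω‖ ∂μ ≤ ∫ _, normTerm Φ Δ ∂μ :=
          integral_mono (hintg Δ).norm (integrable_const _) (aterm_abs_le hl Δ)
      _ = normTerm Φ Δ := by simp
  have h1 := integral_tsum_of_summable_integral_norm hintg hsum
  simp only [AFn_eq]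
  rw [integral_neg, ← h1, ← (sh x).tsum_eq]
  congr 1
  refine tsum_congr fun Δ => ?_
  unfold aterm mterm
  split_ifs
  · exact mn_sh hl ht μ hμ x Δ
  · simp

lemma energy_AFn {Φ : Interaction d F} (hl : IsLocal Φ) (ht : TransInv Φ) (hs : AbsSummable Φ)
    (μ : Measure (V d → F)) [IsProbabilityMeasure μ] (hμ : MeasTransInv μ) (Λ : Finset (V d)) :
    ∫ ω, En Φ Λ ω ∂μ + (Λ.card : ℝ) * ∫ ω, AFn Φ ω ∂μ ≤ bd Φ Λ := by
  classical
  set P := Λ.powerset.erase ∅ with hP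
  have e1 : ∫ ω, En Φ Λ ω ∂μ = ∑ Δ ∈ P, mn Φ μ Δ := by
    unfold En
    rw [integral_finsetSum _ fun Δ _ => inter_integrable hl Δ μ]
    rfl
  have e2 : ∑ Δ ∈ P, mn Φ μ Δ = ∑ x ∈ Λ, ∑ Δ ∈ P, mterm Φ μ x Δ := by
    rw [Finset.sum_comm]
    refine Finset.sum_congr rfl fun Δ hΔ => ?_
    rw [hP, Finset.mem_erase, Finset.mem_powerset] at hΔ
    obtain ⟨x, hx, hxm⟩ := exists_mid hΔ.1
    rw [Finset.sum_eq_single_of_mem x (hΔ.2 hx)]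
    · rw [mterm, if_pos ((hxm x).2 rfl)]
    · intro y _ hy
      rw [mterm, if_neg fun h => hy ((hxm y).1 h)]
  have e3 : (Λ.card : ℝ) * ∫ ω, AFn Φ ω ∂μ = ∑ x ∈ Λ, -∑' Δ, mterm Φ μ x Δ := by
    rw [← nsmul_eq_mul, ← Finset.sum_const]
    exact Finset.sum_congr rfl fun x _ => integral_AFn hl ht hs μ hμ x
  rw [e1, e2, e3, ← Finset.sum_add_distrib, bd]
  refine Finset.sum_le_sum fun x hx => ?_
  have hsm : Summable (mterm Φ μ x) :=
    Summable.of_norm_bounded (wt_true_summable ht hs x) (mterm_abs_le hl μ x)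
  have e4 : ∑ Δ ∈ P, mterm Φ μ x Δ = ∑' Δ, if Δ ∈ P then mterm Φ μ x Δ else 0 := by
    rw [tsum_eq_sum (s := P) (fun Δ h => if_neg h)]
    exact Finset.sum_congr rfl fun Δ h => (if_pos h).symm
  have hsm2 : Summable (fun Δ => if Δ ∈ P then mterm Φ μ x Δ else 0) :=
    summable_of_ne_finset_zero (s := P) fun Δ h => if_neg h
  rw [e4, ← sub_eq_add_neg, ← hsm2.tsum_sub hsm]
  unfold W
  refine (le_abs_self _).trans ?_
  rw [← Real.norm_eq_abs]
  refine tsum_of_norm_bounded (wt_summable ht hs x (fun Δ => ¬ Δ ⊆ Λ)).hasSum fun Δ => ?_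
  by_cases h : Δ ∈ P
  · rw [if_pos h, sub_self, norm_zero]
    exact wt_nonneg _ _ _ _
  · rw [if_neg h, zero_sub, norm_neg]
    by_cases hx2 : x ∈ Δ
    · have : ¬ Δ ⊆ Λ := fun h' => h (by
        rw [hP, Finset.mem_erase, Finset.mem_powerset]
        exact ⟨Finset.nonempty_iff_ne_empty.1 ⟨x, hx2⟩, h'⟩)
      refine (mterm_abs_le hl μ x Δ).trans (le_of_eq ?_)
      unfold wt
      rw [if_pos ⟨hx2, trivial⟩, if_pos ⟨hx2, this⟩]
    · refine (mterm_abs_le hl μ x Δ).trans ?_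
      rw [wt, if_neg fun h => hx2 h.1]
      exact wt_nonneg _ _ _ _

/-- The easy half of the variational principle. -/
lemma variational (hd : 1 ≤ d) {Φ : Interaction d F} (hl : IsLocal Φ) (ht : TransInv Φ)
    (hs : AbsSummable Φ) (μ : Measure (V d → F)) [IsProbabilityMeasure μ] (hμ : MeasTransInv μ) :
    entropy μ + ∫ ω, AFn Φ ω ∂μ ≤ pressure Φ := by
  have key : ∀ Λ, Hent μ Λ + (Λ.card : ℝ) * ∫ ω, AFn Φ ω ∂μ ≤ Real.log (Zp Φ Λ) + bd Φ Λ := by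
    intro Λ
    have h1 := Hent_le μ Λ (fun f => Real.exp (-(En Φ Λ (fill Λ f junkCfg))))
      (fun f => Real.exp_pos _)
    simp only [Real.log_exp] at h1
    rw [← integral_restrict μ Λ (fun f => -(En Φ Λ (fill Λ f junkCfg))), integral_neg] at h1
    have e : ∀ ω, En Φ Λ (fill Λ (Λ.restrict ω) junkCfg) = En Φ Λ ω := fun ω =>
      En_local hl fun x hx => by rw [fill_apply_mem _ _ hx]; rfl
    simp only [e] at h1
    have h2 := energy_AFn hl ht hs μ hμ Λ
    change _ ≤ Real.log (Zp Φ Λ) at h1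
    linarith
  have t1 := (entropy_spec μ hμ).1.add_const (∫ ω, AFn Φ ω ∂μ)
  have t2 := (pressure_spec hd hl ht hs).add (bd_tendsto ht hs)
  rw [add_zero] at t2
  refine le_of_tendsto_of_tendsto' t1 t2 fun n => ?_
  have hc := card_B_pos d n
  have := div_le_div_of_nonneg_right (key (B d n)) hc.le
  rw [add_div, add_div, mul_div_cancel_left₀ _ hc.ne'] at this
  exact this

/-! ### Perturbations -/

lemma Iadd_local {Φ Ψ : Interaction d F} (h1 : IsLocal Φ) (h2 : IsLocal Ψ) :
    IsLocal (Iadd Φ Ψ) := fun Λ ω ω' h => by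
  unfold Iadd
  rw [h1 Λ ω ω' h, h2 Λ ω ω' h]

lemma Iadd_transInv {Φ Ψ : Interaction d F} (h1 : TransInv Φ) (h2 : TransInv Ψ) :
    TransInv (Iadd Φ Ψ) := fun a Λ ω => by
  unfold Iadd
  rw [h1 a Λ ω, h2 a Λ ω]

lemma Iadd_summable {Φ Ψ : Interaction d F} (l1 : IsLocal Φ) (l2 : IsLocal Ψ)
    (h1 : AbsSummable Φ) (h2 : AbsSummable Ψ) : AbsSummable (Iadd Φ Ψ) := by
  refine Summable.of_nonneg_of_le (fun Δ => ?_) (fun Δ => ?_) (Summable.add h1 h2)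
  · unfold normTerm
    split_ifs
    · exact supNorm_nonneg _ _
    · exact le_rfl
  · unfold normTerm
    split_ifs
    · refine ciSup_le fun ω => (abs_add_le _ _).trans
        (add_le_add (abs_le_supNorm l1 Δ ω) (abs_le_supNorm l2 Δ ω))
    · simp

lemma pressure_perturb (hd : 1 ≤ d) {Φ Ψ : Interaction d F} (l1 : IsLocal Φ) (l2 : IsLocal Ψ)
    (t1 : TransInv Φ) (t2 : TransInv Ψ) (h1 : AbsSummable Φ) (h2 : AbsSummable Ψ) :
    pressure Φ ≤ pressure (Iadd Φ Ψ) + anorm Ψ := by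
  have p1 := pressure_spec hd l1 t1 h1
  have p2 := pressure_spec hd (Iadd_local l1 l2) (Iadd_transInv t1 t2)
    (Iadd_summable l1 l2 h1 h2)
  refine le_of_tendsto_of_tendsto' p1 (p2.add_const (anorm Ψ)) fun n => ?_
  have key : Zp Φ (B d n) ≤
      Real.exp (anorm Ψ * ((B d n).card : ℝ)) * Zp (Iadd Φ Ψ) (B d n) := by
    unfold Zp
    rw [Finset.mul_sum]
    refine Finset.sum_le_sum fun f _ => ?_
    rw [← Real.exp_add, Real.exp_le_exp]
    have e : ∀ ω, En (Iadd Φ Ψ) (B d n) ω = En Φ (B d n) ω + En Ψ (B d n) ω := fun ω =>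
      Finset.sum_add_distrib
    rw [e]
    have := (abs_le.1 (En_abs_le l2 t2 h2 (B d n) (fill (B d n) f junkCfg))).2
    linarith
  have k2 := Real.log_le_log (Zp_pos _ _) key
  rw [Real.log_mul (Real.exp_pos _).ne' (Zp_pos _ _).ne', Real.log_exp] at k2
  have hc := card_B_pos d n
  have := div_le_div_of_nonneg_right k2 hc.le
  rw [add_div, mul_div_cancel_right₀ _ hc.ne'] at this
  linarith

lemma AFn_add {Φ Ψ : Interaction d F} (l1 : IsLocal Φ) (l2 : IsLocal Ψ)
    (h1 : AbsSummable Φ) (h2 : AbsSummable Ψ) (ω : V d → F) :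
    AFn (Iadd Φ Ψ) ω = AFn Φ ω + AFn Ψ ω := by
  have s1 : Summable fun Δ => aterm Φ Δ ω :=
    Summable.of_norm_bounded h1 fun Δ => aterm_abs_le l1 Δ ω
  have s2 : Summable fun Δ => aterm Ψ Δ ω :=
    Summable.of_norm_bounded h2 fun Δ => aterm_abs_le l2 Δ ω
  rw [AFn_eq, AFn_eq, AFn_eq, ← neg_add, ← s1.tsum_add s2]
  congr 1
  refine tsum_congr fun Δ => ?_
  unfold aterm Iadd
  split_ifs <;> simp

lemma equilibrium_perturb (hd : 1 ≤ d) {Φ Ψ : Interaction d F} (l1 : IsLocal Φ) (l2 : IsLocal Ψ)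
    (t1 : TransInv Φ) (t2 : TransInv Ψ) (h1 : AbsSummable Φ) (h2 : AbsSummable Ψ)
    (μ : Measure (V d → F)) (hμ : IsEquilibrium (Iadd Φ Ψ) μ) :
    pressure Φ - 2 * anorm Ψ ≤ entropy μ + ∫ ω, AFn Φ ω ∂μ := by
  obtain ⟨hp, hi, he⟩ := hμ
  have h3 := pressure_perturb hd l1 l2 t1 t2 h1 h2
  have e : ∫ ω, AFn (Iadd Φ Ψ) ω ∂μ = ∫ ω, AFn Φ ω ∂μ + ∫ ω, AFn Ψ ω ∂μ := by
    simp only [AFn_add l1 l2 h1 h2]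
    exact integral_add (AFn_integrable l1 h1 μ) (AFn_integrable l2 h2 μ)
  have b : ‖∫ ω, AFn Ψ ω ∂μ‖ ≤ anorm Ψ := by
    have := norm_integral_le_of_norm_le_const (μ := μ) (f := AFn Ψ) (C := anorm Ψ)
      (Eventually.of_forall fun ω => AFn_abs_le l2 h2 ω)
    simpa using this
  have := (abs_le.1 b).2
  linarith

/-! ### Topology -/

lemma cyl_isClopen (Λ : Finset (V d)) (f : ↥Λ → F) :
    IsClopen ((Λ.restrict : (V d → F) → (↥Λ → F)) ⁻¹' {f}) :=
  (isClopen_discrete {f}).preimage (Finset.continuous_restrict Λ)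

lemma cylProb_continuous (Λ : Finset (V d)) (f : ↥Λ → F) :
    Continuous fun μ : ProbabilityMeasure (V d → F) => cylProb (μ : Measure (V d → F)) Λ f := by
  rw [continuous_iff_continuousAt]
  intro μ
  have := ProbabilityMeasure.tendsto_measure_of_isClopen_of_tendsto
    (tendsto_id (α := ProbabilityMeasure (V d → F)) (x := 𝓝 μ)) (cyl_isClopen Λ f)
  have h2 := (NNReal.continuous_coe.tendsto _).comp this
  refine Tendsto.congr (fun ν => ?_) (h2.trans (le_of_eq ?_))
  · rw [cylProb_eq]; rfl
  · beta_reduce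
    rw [cylProb_eq]; rfl

lemma Hent_continuous (Λ : Finset (V d)) :
    Continuous fun μ : ProbabilityMeasure (V d → F) => Hent (μ : Measure (V d → F)) Λ := by
  unfold Hent
  exact continuous_finsetSum _ fun f _ => Real.continuous_negMulLog.comp (cylProb_continuous Λ f)

lemma integral_AFn_continuous {Φ : Interaction d F} (hl : IsLocal Φ) (hs : AbsSummable Φ) :
    Continuous fun μ : ProbabilityMeasure (V d → F) =>
      ∫ ω, AFn Φ ω ∂(μ : Measure (V d → F)) := by
  exact ProbabilityMeasure.continuous_integral_boundedContinuousFunction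
    (BoundedContinuousFunction.ofNormedAddCommGroup (AFn Φ) (AFn_continuous hl hs) (anorm Φ)
      (AFn_abs_le hl hs))

lemma isClosed_transInv :
    IsClosed {μ : ProbabilityMeasure (V d → F) | MeasTransInv (μ : Measure (V d → F))} := by
  have hc : ∀ a : V d, Continuous (translate a : (V d → F) → V d → F) := fun a =>
    continuous_pi fun x => continuous_apply (x + a)
  have : {μ : ProbabilityMeasure (V d → F) | MeasTransInv (μ : Measure (V d → F))} =
      ⋂ a : V d, {μ | μ.map (hc a).measurable.aemeasurable = μ} := by
    ext μ
    simp only [Set.mem_ofPred_eq, Set.mem_iInter, MeasTransInv]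
    refine forall_congr' fun a => ?_
    exact ⟨fun h => Subtype.ext h, fun h => congrArg Subtype.val h⟩
  rw [this]
  exact isClosed_iInter fun a =>
    isClosed_eq (ProbabilityMeasure.continuous_map (hc a)) continuous_id

end Var

/-- upper semicontinuity of equilibrium states under perturbations: for any
weak*-open neighborhood `U` of the set of equilibrium states of `Φ₀`, there is
`0 < δ < 1` such that for every translation invariant `Ψ` with `‖Ψ‖ < δ`, every
equilibrium state of `Φ₀ + Ψ` lies in `U`. -/
theorem equilibrium_upper_semicontinuity (d : ℕ) (hd : 1 ≤ d)
    (F : Type*) [Fintype F] [Nonempty F] [MeasurableSpace F]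
    [TopologicalSpace F] [DiscreteTopology F] [BorelSpace F]
    (Φ₀ : Interaction d F) (hl0 : IsLocal Φ₀) (ht0 : TransInv Φ₀)
    (hs0 : AbsSummable Φ₀)
    (U : Set (ProbabilityMeasure (V d → F))) (hU : IsOpen U)
    (hU0 : {μ : ProbabilityMeasure (V d → F) |
      IsEquilibrium Φ₀ (μ : Measure (V d → F))} ⊆ U) :
    ∃ δ : ℝ, 0 < δ ∧ δ < 1 ∧
      ∀ Ψ : Interaction d F, IsLocal Ψ → TransInv Ψ → AbsSummable Ψ → anorm Ψ < δ →
        {μ : ProbabilityMeasure (V d → F) |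
          IsEquilibrium (Iadd Φ₀ Ψ) (μ : Measure (V d → F))} ⊆ U := by
  by_contra hcon
  set K : ℕ → Set (ProbabilityMeasure (V d → F)) := fun j =>
    ({μ | MeasTransInv (μ : Measure (V d → F))} ∩
      ⋂ n : ℕ, {μ : ProbabilityMeasure (V d → F) |
        pressure Φ₀ - 2 * (1 / ((j : ℝ) + 2)) ≤
          Hent (μ : Measure (V d → F)) (B d n) / ((B d n).card : ℝ) +
            ∫ ω, AFn Φ₀ ω ∂(μ : Measure (V d → F))}) ∩ Uᶜ with hK
  have hclosed : ∀ j, IsClosed (K j) := fun j =>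
    (isClosed_transInv.inter (isClosed_iInter fun n =>
      isClosed_le continuous_const
        (((Hent_continuous (B d n)).div_const _).add (integral_AFn_continuous hl0 hs0)))).inter
      hU.isClosed_compl
  have hanti : ∀ j, K (j + 1) ⊆ K j := by
    rintro j μ ⟨⟨h1, h2⟩, h3⟩
    refine ⟨⟨h1, Set.mem_iInter.2 fun n => ?_⟩, h3⟩
    have h4 := Set.mem_iInter.1 h2 n
    have h5 : 1 / (((j + 1 : ℕ) : ℝ) + 2) ≤ 1 / ((j : ℝ) + 2) := by
      apply one_div_le_one_div_of_le (by positivity)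
      push_cast
      linarith
    rw [Set.mem_setOf_eq] at h4 ⊢
    linarith
  have hne : ∀ j, (K j).Nonempty := by
    intro j
    by_contra hj
    apply hcon
    refine ⟨1 / ((j : ℝ) + 2), by positivity, ?_, ?_⟩
    · rw [div_lt_one (by positivity)]
      have : (0 : ℝ) ≤ j := Nat.cast_nonneg j
      linarith
    · intro Ψ l2 t2 s2 hΨ μ hμ
      by_contra hμU
      refine hj ⟨μ, ⟨hμ.2.1, Set.mem_iInter.2 fun n => ?_⟩, hμU⟩
      have h1 := equilibrium_perturb hd hl0 l2 ht0 t2 hs0 s2 _ hμ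
      have h2 := (entropy_spec (μ : Measure (V d → F)) hμ.2.1).2 n
      change pressure Φ₀ - 2 * (1 / ((j : ℝ) + 2)) ≤ _
      linarith
  obtain ⟨μ, hμ⟩ := IsCompact.nonempty_iInter_of_sequence_nonempty_isCompact_isClosed K hanti hne
    (hclosed 0).isCompact hclosed
  rw [Set.mem_iInter] at hμ
  have hinv : MeasTransInv (μ : Measure (V d → F)) := (hμ 0).1.1
  refine (hμ 0).2 (hU0 ⟨inferInstance, hinv, le_antisymm (variational hd hl0 ht0 hs0 _ hinv) ?_⟩)
  refine ge_of_tendsto' ((entropy_spec (μ : Measure (V d → F)) hinv).1.add_const _) fun n => ?_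
  have hlim : Tendsto (fun j : ℕ => pressure Φ₀ - 2 * (1 / ((j : ℝ) + 2))) atTop
      (𝓝 (pressure Φ₀ - 2 * 0)) := by
    refine tendsto_const_nhds.sub (tendsto_const_nhds.mul ?_)
    have h := (tendsto_one_div_add_atTop_nhds_zero_nat (𝕜 := ℝ)).comp (tendsto_add_atTop_nat 1)
    refine h.congr fun j => ?_
    simp only [Function.comp, Nat.cast_add, Nat.cast_one]
    ring
  rw [mul_zero, sub_zero] at hlim
  exact le_of_tendsto' hlim fun j => Set.mem_iInter.1 (hμ j).1.2 n

end
end LatticeF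
end
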